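/- Let A ⊂ 𝔸 be a closed essential topological annulus with distortion dist(A) > 1. Then lw(A) ≤ diam(pr₂(A)) / (dist(A) − 1). -/

import Mathlib

/- STATEMENT 14: For a closed essential topological annulus `A ⊆ 𝔸` with
distortion `dist(A) > 1`, one has `lw(A) ≤ diam(pr₂(A)) / (dist(A) − 1)`. -/

noncomputable section
open Set Metric Filter Topology Function

abbrev 𝕊 : Type := AddCircle (1:ℝ)
abbrev 𝔸 : Type := 𝕊 × ℝ
abbrev 𝕋2 : Type := 𝕊 × 𝕊

def τ : ℝ × ℝ → 𝔸 := fun p => ((p.1 : 𝕊), p.2)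
def θ : 𝔸 → 𝕋2 := fun p => (p.1, (p.2 : 𝕊))

/-- The connected components of a set `S ⊆ 𝔸`. -/
def comps (S : Set 𝔸) : Set (Set 𝔸) := {C | ∃ z ∈ S, C = connectedComponentIn S z}

/-- A subset of the annulus is unbounded above. -/
def UnbAbove (C : Set 𝔸) : Prop := ¬ BddAbove (Prod.snd '' C)
/-- A subset of the annulus is unbounded below. -/
def UnbBelow (C : Set 𝔸) : Prop := ¬ BddBelow (Prod.snd '' C)

/-- An essential continuum: a compact connected set whose complement has exactly two
unbounded connected components, one unbounded above, the other unbounded below. -/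
def IsEssentialContinuum (E : Set 𝔸) : Prop :=
  IsCompact E ∧ IsConnected E ∧
  ∃ U V : Set 𝔸, U ∈ comps Eᶜ ∧ V ∈ comps Eᶜ ∧ U ≠ V ∧
    UnbAbove U ∧ ¬ UnbBelow U ∧ UnbBelow V ∧ ¬ UnbAbove V ∧
    ∀ C ∈ comps Eᶜ, ¬ Bornology.IsBounded C → C = U ∨ C = V

/-- The lower unbounded complementary region `U⁻(E)` of an essential continuum. -/
def Uminus (E : Set 𝔸) : Set 𝔸 :=
  {z | z ∉ E ∧ UnbBelow (connectedComponentIn Eᶜ z)}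

/-- The partial order `C₁ ≺ C₂` on essential continua. -/
def Prec (C₁ C₂ : Set 𝔸) : Prop := C₁ ⊆ Uminus C₂

/-- An essential annular continuum: a compact connected set whose complement has
exactly two connected components, both unbounded. -/
def IsEssentialAnnularContinuum (E : Set 𝔸) : Prop :=
  IsCompact E ∧ IsConnected E ∧
  ∃ U V : Set 𝔸, U ∈ comps Eᶜ ∧ V ∈ comps Eᶜ ∧ U ≠ V ∧
    UnbAbove U ∧ UnbBelow V ∧ ∀ C ∈ comps Eᶜ, C = U ∨ C = V

/-- The infimum distance between two subsets of the annulus. -/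
def setDist (s t : Set 𝔸) : ℝ := sInf {r | ∃ x ∈ s, ∃ y ∈ t, r = dist x y}

/-- The upper width of `A ⊆ 𝔸`. -/
def uw (A : Set 𝔸) : ℝ :=
  sSup {r | ∃ C₁ C₂ : Set 𝔸, IsEssentialContinuum C₁ ∧ IsEssentialContinuum C₂ ∧
    C₁ ⊆ A ∧ C₂ ⊆ A ∧ r = hausdorffDist C₁ C₂}

/-- The lower width of `A ⊆ 𝔸`. -/
def lw (A : Set 𝔸) : ℝ :=
  sSup {r | ∃ C₁ C₂ : Set 𝔸, IsEssentialContinuum C₁ ∧ IsEssentialContinuum C₂ ∧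
    C₁ ⊆ A ∧ C₂ ⊆ A ∧ r = setDist C₁ C₂}

/-- A horizontal annular continuum in the torus. -/
def IsHorizontalAnnularContinuum (C : Set 𝕋2) : Prop :=
  IsCompact C ∧ IsConnected C ∧
  ∀ z ∈ θ ⁻¹' C, IsEssentialAnnularContinuum (connectedComponentIn (θ ⁻¹' C) z)

/-- A horizontal map `h : 𝕋² → S¹`. -/
def IsHorizontalMap (h : 𝕋2 → 𝕊) : Prop :=
  Continuous h ∧ Function.Surjective h ∧ ∀ t : 𝕊, IsHorizontalAnnularContinuum (h ⁻¹' {t})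

/-- The lower density of a set of natural numbers. -/
def lowerDensity (G : Set ℕ) : ℝ :=
  liminf (fun n : ℕ => ((G ∩ Set.Icc 1 n).ncard : ℝ) / n) atTop

/-- An essential simple loop, regarded as a subset of the annulus. -/
def IsEssentialSimpleLoop (Γ : Set 𝔸) : Prop :=
  (∃ γ : 𝕊 → 𝔸, Continuous γ ∧ Function.Injective γ ∧ Γ = Set.range γ) ∧
  IsEssentialContinuum Γ

/-- A closed essential topological annulus: a homeomorphic copy of `S¹ × [0,1]`
containing an essential loop. -/
def IsClosedEssentialAnnulus (A : Set 𝔸) : Prop :=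
  (∃ φ : 𝕊 × (Set.Icc (0:ℝ) 1) → 𝔸, Continuous φ ∧ Function.Injective φ ∧ A = Set.range φ) ∧
  ∃ Γ ⊆ A, IsEssentialSimpleLoop Γ

/-- `σt` is a continuous lift of the arc `σ : [a,b] → 𝔸` through `τ`. -/
def IsLiftOn (σt : ℝ → ℝ × ℝ) (σ : ℝ → 𝔸) (a b : ℝ) : Prop :=
  ContinuousOn σt (Set.Icc a b) ∧ ∀ s ∈ Set.Icc a b, τ (σt s) = σ s

/-- The homotopical diameter of an arc `σ : [a,b] → 𝔸` (computed through any
lift; all lifts give the same value). -/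
def Dval (σ : ℝ → 𝔸) (a b : ℝ) : ℝ :=
  sInf {r | ∃ σt : ℝ → ℝ × ℝ, IsLiftOn σt σ a b ∧
    r = Metric.diam (Prod.fst '' (σt '' Set.Icc a b))}

/-- The distortion of a loop with image `Γ`: the supremum of the homotopical
diameters of the simple arcs contained in `Γ`. -/
def loopDistortion (Γ : Set 𝔸) : ℝ :=
  sSup {r | ∃ (a b : ℝ) (σ : ℝ → 𝔸), a ≤ b ∧ ContinuousOn σ (Set.Icc a b) ∧
    Set.InjOn σ (Set.Icc a b) ∧ σ '' Set.Icc a b ⊆ Γ ∧ r = Dval σ a b}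

/-- The distortion of a closed essential topological annulus `A`: the infimum
of the distortions of the essential loops contained in `A`. -/
def annDistortion (A : Set 𝔸) : ℝ :=
  sInf {r | ∃ Γ : Set 𝔸, IsEssentialSimpleLoop Γ ∧ Γ ⊆ A ∧ r = loopDistortion Γ}

theorem isOpenQuotientMap_τ : IsOpenQuotientMap τ :=
  (QuotientAddGroup.isOpenQuotientMap_mk (G := ℝ)).prodMap IsOpenQuotientMap.id

theorem continuous_τ : Continuous τ := isOpenQuotientMap_τ.continuous

instance : LocallyPathConnectedSpace 𝔸 :=
  isOpenQuotientMap_τ.isQuotientMap.locallyPathConnectedSpace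

instance : PreconnectedSpace 𝔸 :=
  isOpenQuotientMap_τ.surjective.denseRange.preconnectedSpace continuous_τ

/-- A continuous function with values in `2πiℤ` is constant. -/
theorem eq_of_forall_int_mul_two_pi {X : Type*} [TopologicalSpace X] [PreconnectedSpace X]
    {f : X → ℂ} (hf : Continuous f) (h : ∀ x, ∃ n : ℤ, f x = n * (2 * Real.pi * Complex.I))
    (x y : X) : f x = f y := by
  choose n hn using h
  have hn' : Continuous n := by
    rw [Int.isClosedEmbedding_coe_real.isEmbedding.continuous_iff]
    have : ((↑) ∘ n : X → ℝ) = fun x => (f x).im / (2 * Real.pi) := by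
      ext x
      have : Real.pi ≠ 0 := Real.pi_ne_zero
      simp [hn]
    rw [this]
    fun_prop
  rw [hn, hn, PreconnectedSpace.constant inferInstance hn' (x := x) (y := y)]

theorem exists_log_of_ne_zero {F : ℝ × ℝ → ℂ} (hF : Continuous F) (h0 : ∀ p, F p ≠ 0) :
    ∃ L : ℝ × ℝ → ℂ, Continuous L ∧ ∀ p, Complex.exp (L p) = F p := by
  obtain ⟨L, ⟨-, hL⟩, -⟩ := Complex.isCoveringMapOn_exp.existsUnique_continuousMap_lifts
    (⟨F, hF⟩ : C(ℝ × ℝ, ℂ)) (a₀ := 0) (e₀ := Complex.log (F 0)) (Complex.exp_log (h0 0))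
    (fun a => h0 a)
  exact ⟨L, L.continuous, fun p => congrFun hL p⟩

theorem fourier_coe_one (m : ℤ) (x : ℝ) :
    (fourier m (x : 𝕊) : ℂ) = Complex.exp (2 * Real.pi * Complex.I * m * x) := by
  simp

/-- The loop `f` in `ℂ \ {0}` has degree `m`. -/
def HasDeg (f : 𝕊 → ℂ) (m : ℤ) : Prop :=
  ∃ g : 𝕊 → ℂ, Continuous g ∧ ∀ x, f x = fourier m x * Complex.exp (g x)

/-- A nowhere vanishing function on the annulus has a degree, which is the same on every
horizontal circle. -/
theorem exists_fourier_mul_exp {G : 𝔸 → ℂ} (hG : Continuous G) (h0 : ∀ p, G p ≠ 0) :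
    ∃ (m : ℤ) (g : 𝔸 → ℂ), Continuous g ∧ ∀ p, G p = fourier m p.1 * Complex.exp (g p) := by
  obtain ⟨L, hL, hLG⟩ := exists_log_of_ne_zero (hG.comp continuous_τ) fun p => h0 _
  have hD : ∀ p : ℝ × ℝ, ∃ n : ℤ,
      L (p.1 + 1, p.2) - L p = n * (2 * Real.pi * Complex.I) := by
    intro p
    have : Complex.exp (L (p.1 + 1, p.2)) = Complex.exp (L p) := by
      rw [hLG, hLG]
      simp [τ]
    obtain ⟨n, hn⟩ := Complex.exp_eq_exp_iff_exists_int.1 this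
    exact ⟨n, by rw [hn]; ring⟩
  obtain ⟨m, hm⟩ := hD 0
  have hD' : ∀ p : ℝ × ℝ, L (p.1 + 1, p.2) - L p = m * (2 * Real.pi * Complex.I) := by
    intro p
    rw [← hm]
    exact eq_of_forall_int_mul_two_pi (f := fun p : ℝ × ℝ => L (p.1 + 1, p.2) - L p)
      (by fun_prop) hD p 0
  have hper : ∀ y : ℝ, Function.Periodic
      (fun x : ℝ => L (x, y) - 2 * Real.pi * Complex.I * m * x) 1 := by
    intro y x
    have := hD' (x, y)
    simp only at this ⊢
    push_cast
    linear_combination this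
  refine ⟨m, fun p => (hper p.2).lift p.1, ?_, ?_⟩
  · rw [isOpenQuotientMap_τ.isQuotientMap.continuous_iff]
    change Continuous fun p : ℝ × ℝ => L (p.1, p.2) - 2 * Real.pi * Complex.I * m * p.1
    fun_prop
  · intro p
    obtain ⟨⟨x, y⟩, rfl⟩ := isOpenQuotientMap_τ.surjective p
    change G (τ (x, y)) = fourier m (x : 𝕊) *
      Complex.exp (L (x, y) - 2 * Real.pi * Complex.I * m * x)
    rw [fourier_coe_one, ← Complex.exp_add, add_sub_cancel, hLG]
    rfl

theorem HasDeg.ne_zero {f : 𝕊 → ℂ} {m : ℤ} (h : HasDeg f m) (x : 𝕊) : f x ≠ 0 := by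
  obtain ⟨g, -, hg⟩ := h
  rw [hg, fourier_apply]
  exact mul_ne_zero (Circle.coe_ne_zero _) (Complex.exp_ne_zero _)

theorem HasDeg.unique {f : 𝕊 → ℂ} {m n : ℤ} (hm : HasDeg f m) (hn : HasDeg f n) : m = n := by
  obtain ⟨g, hg, hgf⟩ := hm
  obtain ⟨g', hg', hgf'⟩ := hn
  have key := eq_of_forall_int_mul_two_pi
    (f := fun x : ℝ => (2 * Real.pi * Complex.I * m * x + g (x : 𝕊)) -
      (2 * Real.pi * Complex.I * n * x + g' (x : 𝕊)))
    (by have := AddCircle.continuous_mk' (1 : ℝ); fun_prop) (by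
      intro x
      have : Complex.exp (2 * Real.pi * Complex.I * m * x + g (x : 𝕊)) =
          Complex.exp (2 * Real.pi * Complex.I * n * x + g' (x : 𝕊)) := by
        rw [Complex.exp_add, Complex.exp_add, ← fourier_coe_one, ← fourier_coe_one, ← hgf, hgf']
      obtain ⟨k, hk⟩ := Complex.exp_eq_exp_iff_exists_int.1 this
      exact ⟨k, by rw [hk]; ring⟩) 1 0
  have h1 : ((1 : ℝ) : 𝕊) = ((0 : ℝ) : 𝕊) := by
    simp
  rw [h1] at key
  have h2 : (m : ℂ) = n := by
    have hpi : (2 * Real.pi * Complex.I : ℂ) ≠ 0 := Complex.two_pi_I_ne_zero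
    apply mul_left_cancel₀ hpi
    push_cast at key
    linear_combination key
  exact_mod_cast h2

theorem hasDeg_exp {g : 𝕊 → ℂ} (hg : Continuous g) : HasDeg (fun x => Complex.exp (g x)) 0 :=
  ⟨g, hg, by simp⟩

theorem hasDeg_const {c : ℂ} (hc : c ≠ 0) : HasDeg (fun _ => c) 0 :=
  ⟨fun _ => Complex.log c, continuous_const, by simp [Complex.exp_log hc]⟩

theorem HasDeg.mul {f f' : 𝕊 → ℂ} {m n : ℤ} (h : HasDeg f m) (h' : HasDeg f' n) :
    HasDeg (fun x => f x * f' x) (m + n) := by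
  obtain ⟨g, hg, hgf⟩ := h
  obtain ⟨g', hg', hgf'⟩ := h'
  refine ⟨fun x => g x + g' x, by fun_prop, fun x => ?_⟩
  dsimp only
  rw [hgf, hgf', fourier_add, Complex.exp_add]
  ring

theorem fourier_eq_zpow (m : ℤ) (x : 𝕊) : (fourier m x : ℂ) = (fourier 1 x : ℂ) ^ m := by
  simp [fourier_apply, AddCircle.toCircle_zsmul]

theorem HasDeg.zpow {f : 𝕊 → ℂ} {m : ℤ} (h : HasDeg f m) (k : ℤ) :
    HasDeg (fun x => f x ^ k) (m * k) := by
  obtain ⟨g, hg, hgf⟩ := h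
  refine ⟨fun x => k * g x, by fun_prop, fun x => ?_⟩
  dsimp only
  rw [hgf, mul_zpow, Complex.exp_int_mul, fourier_eq_zpow m, fourier_eq_zpow (m * k), zpow_mul]

/-- A perturbation of smaller modulus does not change the degree. -/
theorem HasDeg.sub {f f' : 𝕊 → ℂ} {m : ℤ} (h : HasDeg f m) (hf : Continuous f)
    (hf' : Continuous f') (hlt : ∀ x, ‖f' x‖ < ‖f x‖) : HasDeg (fun x => f x - f' x) m := by
  have h0 := h.ne_zero
  have hs : ∀ x, 1 - f' x / f x ∈ Complex.slitPlane := by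
    intro x
    rw [sub_eq_add_neg]
    apply Complex.mem_slitPlane_of_norm_lt_one
    rw [norm_neg, norm_div, div_lt_one (norm_pos_iff.2 (h0 x))]
    exact hlt x
  have key : HasDeg (fun x => Complex.exp (Complex.log (1 - f' x / f x))) 0 :=
    hasDeg_exp ((continuous_const.sub (hf'.div₀ hf h0)).clog hs)
  have := h.mul key
  rw [add_zero] at this
  convert this using 2 with x
  rw [Complex.exp_log (Complex.slitPlane_ne_zero (hs x))]
  field_simp [h0 x]

/-- The conformal identification of the annulus with the punctured plane. -/
def annExp (p : 𝔸) : ℂ := fourier 1 p.1 * Complex.exp p.2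

theorem continuous_annExp : Continuous annExp := by
  unfold annExp
  fun_prop

theorem norm_annExp (p : 𝔸) : ‖annExp p‖ = Real.exp p.2 := by
  rw [annExp, norm_mul, Complex.norm_exp, fourier_apply, Circle.norm_coe]
  simp

theorem annExp_ne_zero (p : 𝔸) : annExp p ≠ 0 := by
  rw [← norm_pos_iff, norm_annExp]
  positivity

theorem annExp_injective : Function.Injective annExp := by
  intro p q h
  have h2 : p.2 = q.2 := by
    have := congrArg norm h
    rwa [norm_annExp, norm_annExp, Real.exp_eq_exp] at this
  refine Prod.ext ?_ h2
  rw [annExp, annExp, h2, mul_left_inj' (Complex.exp_ne_zero _)] at h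
  simp only [fourier_one] at h
  exact AddCircle.injective_toCircle one_ne_zero (Subtype.ext h)

theorem hasDeg_annExp (y : ℝ) : HasDeg (fun x => annExp (x, y)) 1 :=
  ⟨fun _ => y, continuous_const, fun _ => rfl⟩

section Components

variable {K U V : Set 𝔸}

theorem isOpen_of_mem_comps (hK : IsClosed K) (hU : U ∈ comps Kᶜ) : IsOpen U := by
  obtain ⟨z, -, rfl⟩ := hU
  exact hK.isOpen_compl.connectedComponentIn

theorem isPreconnected_of_mem_comps (hU : U ∈ comps Kᶜ) : IsPreconnected U := by
  obtain ⟨z, -, rfl⟩ := hU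
  exact isPreconnected_connectedComponentIn

theorem nonempty_of_mem_comps (hU : U ∈ comps Kᶜ) : U.Nonempty := by
  obtain ⟨z, hz, rfl⟩ := hU
  exact ⟨z, mem_connectedComponentIn hz⟩

theorem subset_compl_of_mem_comps (hU : U ∈ comps Kᶜ) : U ⊆ Kᶜ := by
  obtain ⟨z, -, rfl⟩ := hU
  exact connectedComponentIn_subset _ _

theorem subset_of_mem_comps (hU : U ∈ comps Kᶜ) {S : Set 𝔸} (hS : IsPreconnected S)
    (hSK : S ⊆ Kᶜ) (h : (S ∩ U).Nonempty) : S ⊆ U := by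
  obtain ⟨z, -, rfl⟩ := hU
  obtain ⟨p, hpS, hpU⟩ := h
  rw [connectedComponentIn_eq hpU]
  exact hS.subset_connectedComponentIn hpS hSK

theorem eq_of_mem_comps (hU : U ∈ comps Kᶜ) (hV : V ∈ comps Kᶜ) (h : (U ∩ V).Nonempty) :
    U = V :=
  (subset_of_mem_comps hV (isPreconnected_of_mem_comps hU) (subset_compl_of_mem_comps hU)
    h).antisymm (subset_of_mem_comps hU (isPreconnected_of_mem_comps hV)
      (subset_compl_of_mem_comps hV) (inter_comm U V ▸ h))

theorem frontier_subset_of_mem_comps (hK : IsClosed K) (hU : U ∈ comps Kᶜ) :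
    frontier U ⊆ K := by
  intro p hp
  by_contra hpK
  rw [(isOpen_of_mem_comps hK hU).frontier_eq] at hp
  have hW : connectedComponentIn Kᶜ p ∈ comps Kᶜ := ⟨p, hpK, rfl⟩
  have hpW : p ∈ connectedComponentIn Kᶜ p := mem_connectedComponentIn hpK
  obtain ⟨q, hq⟩ := mem_closure_iff.1 hp.1 _ (isOpen_of_mem_comps hK hW) hpW
  exact hp.2 (eq_of_mem_comps hW hU ⟨q, hq⟩ ▸ hpW)

theorem isPreconnected_union_of_mem_comps (hK : IsClosed K) (hKc : IsConnected K)
    (hU : U ∈ comps Kᶜ) : IsPreconnected (K ∪ U) := by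
  have hne : U ≠ univ := by
    rintro rfl
    obtain ⟨p, hp⟩ := hKc.nonempty
    exact subset_compl_of_mem_comps hU (mem_univ p) hp
  obtain ⟨p, hp⟩ := nonempty_frontier_iff.2 ⟨nonempty_of_mem_comps hU, hne⟩
  have hpK := frontier_subset_of_mem_comps hK hU hp
  have h1 : IsPreconnected (U ∪ {p}) :=
    (isPreconnected_of_mem_comps hU).subset_closure subset_union_left
      (union_subset subset_closure (singleton_subset_iff.2 (frontier_subset_closure hp)))
  have h2 := IsPreconnected.union p hpK (Or.inr rfl) hKc.isPreconnected h1
  convert h2 using 1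
  ext q
  simp only [mem_union, mem_singleton_iff]
  constructor
  · tauto
  · rintro (h | h | rfl) <;> tauto

end Components

theorem isPreconnected_setOf_lt_snd (M : ℝ) : IsPreconnected {p : 𝔸 | M < p.2} := by
  have : {p : 𝔸 | M < p.2} = univ ×ˢ Ioi M := by ext; simp
  rw [this]
  exact isPreconnected_univ.prod isPreconnected_Ioi

theorem isPreconnected_setOf_snd_lt (M : ℝ) : IsPreconnected {p : 𝔸 | p.2 < M} := by
  have : {p : 𝔸 | p.2 < M} = univ ×ˢ Iio M := by ext; simp
  rw [this]
  exact isPreconnected_univ.prod isPreconnected_Iio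

theorem exists_abs_snd_le {K : Set 𝔸} (hK : IsCompact K) : ∃ M, ∀ p ∈ K, |p.2| ≤ M := by
  obtain ⟨M, hM⟩ := (hK.image continuous_snd).isBounded.exists_norm_le
  exact ⟨M, fun p hp => hM _ (mem_image_of_mem _ hp)⟩

theorem isBounded_iff_exists_abs_snd_le {S : Set 𝔸} :
    Bornology.IsBounded S ↔ ∃ M, ∀ p ∈ S, |p.2| ≤ M := by
  constructor
  · intro h
    obtain ⟨M, hM⟩ := isBounded_iff_forall_norm_le.1 h.image_snd
    exact ⟨M, fun p hp => hM _ (mem_image_of_mem _ hp)⟩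
  · rintro ⟨M, hM⟩
    have h : IsCompact ((univ : Set 𝕊) ×ˢ Icc (-M) M) := isCompact_univ.prod isCompact_Icc
    exact h.isBounded.subset fun p hp => ⟨mem_univ _, abs_le.1 (hM p hp)⟩

/-- The upper and lower complementary regions of an essential continuum. -/
theorem IsEssentialContinuum.exists_sides {C : Set 𝔸} (hC : IsEssentialContinuum C) :
    ∃ U ∈ comps Cᶜ, ∃ V ∈ comps Cᶜ, U ≠ V ∧
      ∃ M, ∀ p : 𝔸, (M < p.2 → p ∈ U) ∧ (p.2 < -M → p ∈ V) := by
  obtain ⟨hcomp, -, U, V, hU, hV, hne, hUa, -, hVb, -, -⟩ := hC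
  obtain ⟨M, hM⟩ := exists_abs_snd_le hcomp
  refine ⟨U, hU, V, hV, hne, M, fun p => ⟨fun hp => ?_, fun hp => ?_⟩⟩
  · refine subset_of_mem_comps hU (isPreconnected_setOf_lt_snd M) (fun q hq hqC => ?_) ?_ hp
    · exact absurd ((le_abs_self _).trans (hM q hqC)) (not_le.2 hq)
    · obtain ⟨_, ⟨q, hqU, rfl⟩, hq⟩ := not_bddAbove_iff.1 hUa M
      exact ⟨q, hq, hqU⟩
  · refine subset_of_mem_comps hV (isPreconnected_setOf_snd_lt (-M)) (fun q hq hqC => ?_) ?_ hp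
    · exact absurd ((neg_le_abs _).trans (hM q hqC)) (not_le.2 (by linarith [mem_ofPred.1 hq]))
    · obtain ⟨_, ⟨q, hqV, rfl⟩, hq⟩ := not_bddBelow_iff.1 hVb (-M)
      exact ⟨q, hq, hqV⟩

/-- A function without zeros off `W` with a logarithm on a closed set containing the frontier
of `W` has the same degree on all horizontal circles avoiding `W`, and this degree vanishes
if some horizontal circle lies in `W`. -/
theorem exists_hasDeg_of_log {E W : Set 𝔸} (hE : IsClosed E) (hW : IsOpen W)
    (hWE : frontier W ⊆ E) {f g : 𝔸 → ℂ} (hf : ContinuousOn f Wᶜ) (h0 : ∀ p ∉ W, f p ≠ 0)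
    (hg : ContinuousOn g E) (hfg : ∀ p ∈ E, f p = Complex.exp (g p)) :
    ∃ m : ℤ, (∀ y, (∀ x, (x, y) ∉ W) → HasDeg (fun x => f (x, y)) m) ∧
      ∀ y, (∀ x, (x, y) ∈ W) → m = 0 := by
  classical
  obtain ⟨γ, hγ⟩ := ContinuousMap.exists_restrict_eq hE ⟨E.domRestrict g, hg.domRestrict⟩
  have hγg : ∀ p ∈ E, γ p = g p := fun p hp => congrArg (fun h => h ⟨p, hp⟩) hγ
  set G : 𝔸 → ℂ := W.piecewise (fun p => Complex.exp (γ p)) f with hGdef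
  have hGW : ∀ p ∈ W, G p = Complex.exp (γ p) := fun p hp => piecewise_eq_of_mem _ _ _ hp
  have hGc : ∀ p ∉ W, G p = f p := fun p hp => piecewise_eq_of_notMem _ _ _ hp
  have hG : Continuous G := by
    refine continuous_piecewise (fun p hp => ?_) (by fun_prop) ?_
    · rw [hfg p (hWE hp), hγg p (hWE hp)]
    · rwa [hW.isClosed_compl.closure_eq]
  have hG0 : ∀ p, G p ≠ 0 := by
    intro p
    by_cases hp : p ∈ W
    · rw [hGW p hp]
      exact Complex.exp_ne_zero _
    · rw [hGc p hp]
      exact h0 p hp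
  obtain ⟨m, l, hl, hGl⟩ := exists_fourier_mul_exp hG hG0
  have hdeg : ∀ y, HasDeg (fun x => G (x, y)) m :=
    fun y => ⟨fun x => l (x, y), by fun_prop, fun x => hGl _⟩
  refine ⟨m, fun y hy => ?_, fun y hy => ?_⟩
  · convert hdeg y using 2 with x
    exact (hGc _ (hy x)).symm
  · refine (hdeg y).unique ?_
    convert hasDeg_exp (g := fun x => γ (x, y)) (by fun_prop) using 2 with x
    exact hGW _ (hy x)

theorem IsEssentialContinuum.not_exists_log {C : Set 𝔸} (hC : IsEssentialContinuum C)
    {g : 𝔸 → ℂ} (hg : ContinuousOn g C) : ¬ ∀ p ∈ C, annExp p = Complex.exp (g p) := by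
  intro h
  obtain ⟨U, hU, V, hV, hne, M, hM⟩ := hC.exists_sides
  have hCc := hC.1.isClosed
  obtain ⟨m, hm, hm0⟩ := exists_hasDeg_of_log hCc (isOpen_of_mem_comps hCc hV)
    (frontier_subset_of_mem_comps hCc hV) continuous_annExp.continuousOn
    (fun p _ => annExp_ne_zero p) hg h
  have h1 := hm (M + 1) fun x hx =>
    hne (eq_of_mem_comps hU hV ⟨_, (hM (x, M + 1)).1 (by simp), hx⟩)
  have h2 := hm0 (-M - 1) fun x => (hM (x, -M - 1)).2 (by simp)
  exact absurd (h1.unique (hasDeg_annExp _)) (by omega)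

/-- The complement of an essential topological annulus has no bounded component. -/
theorem IsClosedEssentialAnnulus.exists_lt_abs_snd {A W : Set 𝔸}
    (hA : IsClosedEssentialAnnulus A) (hW : W ∈ comps Aᶜ) (M : ℝ) : ∃ p ∈ W, M < |p.2| := by
  obtain ⟨⟨φ, hφ, hφi, rfl⟩, Γ, hΓA, -, hΓ⟩ := hA
  by_contra! hbdd
  have hemb := hφ.isClosedEmbedding hφi
  have hAc : IsClosed (range φ) := hemb.isClosed_range
  obtain ⟨z, hz, hWz⟩ := id hW
  have hzW : z ∈ W := hWz ▸ mem_connectedComponentIn hz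
  set ψ : 𝔸 → 𝔸 := fun p => φ (p.1, projIcc 0 1 zero_le_one p.2) with hψdef
  have hψ : Continuous ψ := by fun_prop
  have hψr : ∀ p, ψ p ∈ range φ := fun p => mem_range_self _
  obtain ⟨k, g₁, hg₁, hk⟩ := exists_fourier_mul_exp (continuous_annExp.comp hψ)
    fun p => annExp_ne_zero _
  obtain ⟨m, g₂, hg₂, hm⟩ := exists_fourier_mul_exp
    (G := fun p => annExp (ψ p) - annExp z) (by have := continuous_annExp; fun_prop)
    fun p h => hz (annExp_injective (sub_eq_zero.1 h) ▸ hψr p)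
  have : Nonempty (𝕊 × Icc (0 : ℝ) 1) := ⟨(0, 0)⟩
  obtain ⟨ι, hι⟩ : ∃ ι : 𝔸 → 𝔸, ContinuousOn ι (range φ) ∧ ∀ p ∈ range φ, ψ (ι p) = p := by
    refine ⟨fun p => ((invFun φ p).1, ((invFun φ p).2 : ℝ)), ?_, ?_⟩
    · have h : ContinuousOn (invFun φ) (range φ) := by
        rw [continuousOn_iff_continuous_domRestrict]
        have : (range φ).domRestrict (invFun φ) = hemb.isEmbedding.toHomeomorph.symm := by
          ext1 p
          obtain ⟨q, rfl⟩ := hemb.isEmbedding.toHomeomorph.surjective p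
          rw [Homeomorph.symm_apply_apply]
          exact leftInverse_invFun hφi q
        rw [this]
        exact Homeomorph.continuous _
      exact (continuous_fst.comp_continuousOn h).prodMk
        ((continuous_subtype_val.comp continuous_snd).comp_continuousOn h)
    · rintro _ ⟨q, rfl⟩
      simp only [hψdef, leftInverse_invFun hφi q, projIcc_val, Prod.mk.eta]
  have hk0 : k ≠ 0 := by
    rintro rfl
    refine hΓ.not_exists_log (g := g₁ ∘ ι) (hg₁.comp_continuousOn (hι.1.mono hΓA)) fun p hp => ?_
    have := hk (ι p)
    rw [comp_apply, hι.2 p (hΓA hp)] at this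
    simpa using this
  have hz0 : ∀ p ∉ W, annExp p - annExp z ≠ 0 := fun p hp h =>
    hp (annExp_injective (sub_eq_zero.1 h) ▸ hzW)
  obtain ⟨j, hj, -⟩ := exists_hasDeg_of_log hAc (isOpen_of_mem_comps hAc hW)
    (frontier_subset_of_mem_comps hAc hW)
    (f := fun p => (annExp p - annExp z) ^ k * annExp p ^ (-m))
    (g := fun p => k * g₂ (ι p) + ((-m : ℤ) : ℂ) * g₁ (ι p))
    (by
      have := continuous_annExp
      refine ContinuousOn.mul ?_ ?_
      · exact ContinuousOn.zpow₀ (by fun_prop) _ fun p hp => Or.inl (hz0 p hp)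
      · exact ContinuousOn.zpow₀ (by fun_prop) _ fun p _ => Or.inl (annExp_ne_zero p))
    (fun p hp => mul_ne_zero (zpow_ne_zero _ (hz0 p hp)) (zpow_ne_zero _ (annExp_ne_zero p)))
    (by
      have := hι.1
      fun_prop)
    (fun p hp => by
      have h1 := hk (ι p)
      have h2 := hm (ι p)
      rw [comp_apply, hι.2 p hp] at h1
      simp only [hι.2 p hp] at h2
      rw [h2, h1, Complex.exp_add, Complex.exp_int_mul, Complex.exp_int_mul,
        mul_zpow, mul_zpow, fourier_eq_zpow m, fourier_eq_zpow k, ← zpow_mul, ← zpow_mul]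
      have h3 : ((fourier 1 (ι p).1 : ℂ) ^ (m * k)) * (fourier 1 (ι p).1 : ℂ) ^ (k * -m) = 1 := by
        rw [← zpow_add₀ (by rw [fourier_apply]; exact Circle.coe_ne_zero _)]
        ring_nf
        simp
      linear_combination (Complex.exp (g₂ (ι p)) ^ k * Complex.exp (g₁ (ι p)) ^ (-m)) * h3)
  have hcirc : ∀ y, Continuous fun x : 𝕊 => annExp (x, y) := fun y =>
    continuous_annExp.comp (by fun_prop)
  set N := max |z.2| M + 1 with hN
  have hzN : |z.2| < N := by have := le_max_left |z.2| M; linarith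
  have hMN : M < N := by have := le_max_right |z.2| M; linarith
  have hN0 : 0 < N := (abs_nonneg _).trans_lt hzN
  have htop : HasDeg (fun x => annExp (x, N) - annExp z) 1 := by
    refine (hasDeg_annExp N).sub (hcirc N) continuous_const fun x => ?_
    rw [norm_annExp, norm_annExp, Real.exp_lt_exp]
    exact (le_abs_self _).trans_lt hzN
  have hbot : HasDeg (fun x => annExp (x, -N) - annExp z) 0 := by
    have h := (hasDeg_const (c := annExp z) (annExp_ne_zero z)).sub continuous_const
      (hcirc (-N)) fun x => by
        rw [norm_annExp, norm_annExp, Real.exp_lt_exp]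
        linarith [neg_abs_le z.2]
    have h' := h.mul (hasDeg_const (c := -1) (by simp))
    rw [add_zero] at h'
    convert h' using 2 with x
    ring
  have h1 := (hj N fun x hx => absurd (hbdd _ hx) (not_le.2 (by rwa [abs_of_pos hN0]))).unique
    ((htop.zpow k).mul ((hasDeg_annExp N).zpow (-m)))
  have h2 := (hj (-N) fun x hx => absurd (hbdd _ hx)
    (not_le.2 (by rwa [abs_neg, abs_of_pos hN0]))).unique
    ((hbot.zpow k).mul ((hasDeg_annExp (-N)).zpow (-m)))
  apply hk0
  linarith

/-- A loop of nonzero degree is essential. -/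
theorem isEssentialContinuum_range {γ : 𝕊 → 𝔸} (hγ : Continuous γ) {k : ℤ} (hk : k ≠ 0)
    (hdeg : HasDeg (annExp ∘ γ) k) : IsEssentialContinuum (range γ) := by
  have hK : IsCompact (range γ) := isCompact_range hγ
  obtain ⟨M, hM⟩ := exists_abs_snd_le hK
  have hMγ : ∀ t, |(γ t).2| ≤ M := fun t => hM _ (mem_range_self t)
  have hM0 : 0 ≤ M := (abs_nonneg _).trans (hMγ 0)
  have hhigh : ∀ p : 𝔸, M < p.2 → p ∈ (range γ)ᶜ := fun p hp hpK =>
    absurd ((le_abs_self _).trans (hM p hpK)) (not_le.2 hp)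
  have hlow : ∀ p : 𝔸, p.2 < -M → p ∈ (range γ)ᶜ := fun p hp hpK =>
    absurd ((neg_le_abs _).trans (hM p hpK)) (not_le.2 (by linarith))
  set pu : 𝔸 := (0, M + 1) with hpu
  set pl : 𝔸 := (0, -M - 1) with hpl
  have hpuK : pu ∈ (range γ)ᶜ := hhigh _ (by simp [hpu])
  have hplK : pl ∈ (range γ)ᶜ := hlow _ (by simp [hpl])
  set U := connectedComponentIn (range γ)ᶜ pu with hUdef
  set V := connectedComponentIn (range γ)ᶜ pl with hVdef
  have hU : U ∈ comps (range γ)ᶜ := ⟨_, hpuK, rfl⟩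
  have hV : V ∈ comps (range γ)ᶜ := ⟨_, hplK, rfl⟩
  have hUM : ∀ p : 𝔸, M < p.2 → p ∈ U := fun p hp =>
    subset_of_mem_comps hU (isPreconnected_setOf_lt_snd M) hhigh
      ⟨pu, by simp [hpu], mem_connectedComponentIn hpuK⟩ hp
  have hVM : ∀ p : 𝔸, p.2 < -M → p ∈ V := fun p hp =>
    subset_of_mem_comps hV (isPreconnected_setOf_snd_lt (-M)) hlow
      ⟨pl, by simp [hpl], mem_connectedComponentIn hplK⟩ hp
  have hne : U ≠ V := by
    intro hUV
    have hUo : IsOpen U := isOpen_of_mem_comps hK.isClosed hU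
    have hUp : IsPathConnected U :=
      hUo.isConnected_iff_isPathConnected.1 ⟨⟨pu, mem_connectedComponentIn hpuK⟩,
        isPreconnected_of_mem_comps hU⟩
    obtain ⟨α, hα⟩ := hUp.joinedIn pl (hUV ▸ mem_connectedComponentIn hplK) pu
      (mem_connectedComponentIn hpuK)
    obtain ⟨m, g, hg, hm⟩ := exists_fourier_mul_exp
      (G := fun p => annExp (γ p.1) - annExp (α (projIcc 0 1 zero_le_one p.2)))
      (by have := continuous_annExp; have := α.continuous; fun_prop)
      fun p h => subset_compl_of_mem_comps hU (hα _)
        ⟨p.1, annExp_injective (sub_eq_zero.1 h)⟩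
    have hm' : ∀ s : ℝ, HasDeg
        (fun t => annExp (γ t) - annExp (α (projIcc 0 1 zero_le_one s))) m :=
      fun s => ⟨fun t => g (t, s), by fun_prop, fun t => hm (t, s)⟩
    have hc : Continuous fun t => annExp (γ t) := continuous_annExp.comp hγ
    have h0 := hm' 0
    have h1 := hm' 1
    simp only [projIcc_left, projIcc_right, Path.source, Path.target, Icc.mk_zero, Icc.mk_one]
      at h0 h1
    have e0 : m = k := h0.unique <| hdeg.sub hc continuous_const fun t => by
      simp only [comp_apply, norm_annExp, Real.exp_lt_exp, hpl]
      linarith [neg_abs_le (γ t).2, hMγ t]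
    have h2 := ((hasDeg_const (c := annExp pu) (annExp_ne_zero _)).sub continuous_const hc
      fun t => by
        simp only [norm_annExp, Real.exp_lt_exp, hpu]
        linarith [le_abs_self (γ t).2, hMγ t]).mul (hasDeg_const (c := -1) (by simp))
    have e1 : m = 0 + 0 := h1.unique (by convert h2 using 2 with x; ring)
    omega
  have hdisj : ∀ p, p ∈ U → p ∈ V → False := fun p h h' => hne (eq_of_mem_comps hU hV ⟨p, h, h'⟩)
  refine ⟨hK, isConnected_range hγ, U, V, hU, hV, hne, ?_, ?_, ?_, ?_, ?_⟩
  · refine not_bddAbove_iff.2 fun x => ⟨max x M + 1, ⟨(0, max x M + 1), hUM _ ?_, rfl⟩, ?_⟩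
    · linarith [le_max_right x M]
    · linarith [le_max_left x M]
  · refine not_not.2 ⟨-M, ?_⟩
    rintro _ ⟨p, hp, rfl⟩
    by_contra! h
    exact hdisj p hp (hVM p h)
  · refine not_bddBelow_iff.2 fun x => ⟨min x (-M) - 1, ⟨(0, min x (-M) - 1), hVM _ ?_, rfl⟩, ?_⟩
    · linarith [min_le_right x (-M)]
    · linarith [min_le_left x (-M)]
  · refine not_not.2 ⟨M, ?_⟩
    rintro _ ⟨p, hp, rfl⟩
    by_contra! h
    exact hdisj p (hUM p h) hp
  · intro C hC hCb
    have : ∃ p ∈ C, M < |p.2| := by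
      by_contra! h
      exact hCb (isBounded_iff_exists_abs_snd_le.2 ⟨M, h⟩)
    obtain ⟨p, hpC, hp⟩ := this
    rcases lt_abs.1 hp with h | h
    · exact Or.inl (eq_of_mem_comps hC hU ⟨p, hpC, hUM p h⟩)
    · exact Or.inr (eq_of_mem_comps hC hV ⟨p, hpC, hVM p (by linarith)⟩)

/-- Two disjoint essential continua in a closed essential annulus `A` cut off disjoint closed
neighbourhoods of the two ends, such that the region in between lies in `A`. -/
theorem IsClosedEssentialAnnulus.exists_ends {A C₁ C₂ : Set 𝔸} (hA : IsClosedEssentialAnnulus A)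
    (h₁ : IsEssentialContinuum C₁) (h₂ : IsEssentialContinuum C₂) (hC₁ : C₁ ⊆ A) (hC₂ : C₂ ⊆ A)
    (hd : Disjoint C₁ C₂) :
    ∃ X Y : Set 𝔸, IsClosed X ∧ IsClosed Y ∧ Disjoint X Y ∧
      (frontier X ⊆ C₁ ∧ frontier Y ⊆ C₂ ∨ frontier X ⊆ C₂ ∧ frontier Y ⊆ C₁) ∧
      (∃ M, ∀ p : 𝔸, (p.2 < -M → p ∈ X) ∧ (M < p.2 → p ∈ Y)) ∧ (X ∪ Y)ᶜ ⊆ A := by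
  obtain ⟨U₁, hU₁, V₁, hV₁, hne₁, M₁, hM₁⟩ := h₁.exists_sides
  obtain ⟨U₂, hU₂, V₂, hV₂, hne₂, M₂, hM₂⟩ := h₂.exists_sides
  have key : ∀ {C C' U V U' V' : Set 𝔸} {M M' : ℝ}, IsEssentialContinuum C →
      IsEssentialContinuum C' → C ⊆ A → C' ⊆ A → Disjoint C C' → U ∈ comps Cᶜ → V ∈ comps Cᶜ →
      U' ∈ comps C'ᶜ → U ≠ V → (∀ p : 𝔸, (M < p.2 → p ∈ U) ∧ (p.2 < -M → p ∈ V)) →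
      (∀ p : 𝔸, (M' < p.2 → p ∈ U') ∧ (p.2 < -M' → p ∈ V')) → Disjoint C U' →
      ∃ X Y : Set 𝔸, IsClosed X ∧ IsClosed Y ∧ Disjoint X Y ∧
      (frontier X ⊆ C ∧ frontier Y ⊆ C') ∧
      (∃ M, ∀ p : 𝔸, (p.2 < -M → p ∈ X) ∧ (M < p.2 → p ∈ Y)) ∧ (X ∪ Y)ᶜ ⊆ A := by
    intro C C' U V U' V' M M' hC hC' hCA hCA' hd hU hV hU' hne hM hM' hdU
    have hsub : C' ∪ U' ⊆ U := by
      refine subset_of_mem_comps hU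
        (isPreconnected_union_of_mem_comps hC'.1.isClosed hC'.2.1 hU') ?_ ?_
      · exact (hd.union_right hdU).subset_compl_left
      · refine ⟨(0, max M M' + 1), Or.inr ((hM' _).1 ?_), (hM _).1 ?_⟩
        · linarith [le_max_right M M']
        · linarith [le_max_left M M']
    have hclosed : ∀ {K W : Set 𝔸}, IsClosed K → W ∈ comps Kᶜ →
        IsClosed (K ∪ W) ∧ frontier (K ∪ W) ⊆ K := by
      intro K W hK hW
      have hcl : closure W ⊆ K ∪ W := by
        rw [closure_eq_self_union_frontier, union_comm]
        exact union_subset_union_left _ (frontier_subset_of_mem_comps hK hW)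
      have hc : IsClosed (K ∪ W) := by
        refine isClosed_of_closure_subset ?_
        rw [closure_union, hK.closure_eq]
        exact union_subset subset_union_left hcl
      refine ⟨hc, fun p hp => ?_⟩
      refine (hc.frontier_subset hp).resolve_right fun hpW => hp.2 ?_
      exact interior_maximal subset_union_right (isOpen_of_mem_comps hK hW) hpW
    obtain ⟨hX, hXf⟩ := hclosed hC.1.isClosed hV
    obtain ⟨hY, hYf⟩ := hclosed hC'.1.isClosed hU'
    refine ⟨C ∪ V, C' ∪ U', hX, hY, ?_, ⟨hXf, hYf⟩, ⟨max M M', fun p => ⟨fun hp => ?_,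
      fun hp => ?_⟩⟩, ?_⟩
    · refine Set.disjoint_left.2 fun p hp hp' => ?_
      rcases hp with hp | hp
      · exact subset_compl_of_mem_comps hU (hsub hp') hp
      · exact hne (eq_of_mem_comps hU hV ⟨p, hsub hp', hp⟩)
    · exact Or.inr ((hM p).2 (by linarith [le_max_left M M']))
    · exact Or.inr ((hM' p).1 (by linarith [le_max_right M M']))
    · intro p hp
      by_contra hpA
      have hW : connectedComponentIn Aᶜ p ∈ comps Aᶜ := ⟨p, hpA, rfl⟩
      have hpW : p ∈ connectedComponentIn Aᶜ p := mem_connectedComponentIn hpA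
      have hWp := isPreconnected_of_mem_comps hW
      have hWA := subset_compl_of_mem_comps hW
      obtain ⟨q, hqW, hq⟩ := hA.exists_lt_abs_snd hW (max M M')
      rcases lt_abs.1 hq with hq | hq
      · exact hp (Or.inr (Or.inr (subset_of_mem_comps hU' hWp
          (hWA.trans (compl_subset_compl.2 hCA'))
          ⟨q, hqW, (hM' q).1 (by linarith [le_max_right M M'])⟩ hpW)))
      · exact hp (Or.inl (Or.inr (subset_of_mem_comps hV hWp
          (hWA.trans (compl_subset_compl.2 hCA))
          ⟨q, hqW, (hM q).2 (by linarith [le_max_left M M'])⟩ hpW)))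
  by_cases hd₂ : Disjoint C₁ U₂
  · obtain ⟨X, Y, hX, hY, h, hf, h'⟩ :=
      key h₁ h₂ hC₁ hC₂ hd hU₁ hV₁ hU₂ hne₁ hM₁ hM₂ hd₂
    exact ⟨X, Y, hX, hY, h, Or.inl hf, h'⟩
  · have hsub : C₁ ⊆ U₂ := subset_of_mem_comps hU₂ h₁.2.1.isPreconnected hd.subset_compl_right
      (not_disjoint_iff_nonempty_inter.1 hd₂)
    have hCV : Disjoint C₂ U₁ := by
      by_contra hdU
      have hsub' : C₂ ⊆ U₁ := subset_of_mem_comps hU₁ h₂.2.1.isPreconnected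
        hd.symm.subset_compl_right (not_disjoint_iff_nonempty_inter.1 hdU)
      have hsub₂ : C₁ ∪ V₁ ⊆ V₂ := by
        refine subset_of_mem_comps hV₂
          (isPreconnected_union_of_mem_comps h₁.1.isClosed h₁.2.1 hV₁) ?_ ?_
        · rintro p (hp | hp) hp₂
          · exact Set.disjoint_left.1 hd hp hp₂
          · exact hne₁ (eq_of_mem_comps hU₁ hV₁ ⟨p, hsub' hp₂, hp⟩)
        · refine ⟨(0, -(max M₁ M₂) - 1), Or.inr ((hM₁ _).2 ?_), (hM₂ _).2 ?_⟩
          · linarith [le_max_left M₁ M₂]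
          · linarith [le_max_right M₁ M₂]
      obtain ⟨p, hp⟩ := h₁.2.1.nonempty
      exact hne₂ (eq_of_mem_comps hU₂ hV₂ ⟨p, hsub hp, hsub₂ (Or.inl hp)⟩)
    obtain ⟨X, Y, hX, hY, h, hf, h'⟩ :=
      key h₂ h₁ hC₂ hC₁ hd.symm hU₂ hV₂ hU₁ hne₂ hM₂ hM₁ hCV
    exact ⟨X, Y, hX, hY, h, Or.inr hf, h'⟩

section Grid

/-- `v` and `w` are the endpoints, from left to right or from bottom to top, of an edge of the
integer grid that separates a unit square in `s` from one not in `s`; unit squares are indexed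
by their lower left corners. -/
def IsBoundaryEdge (s : ℤ × ℤ → Prop) (v w : ℤ × ℤ) : Prop :=
  (w = (v.1 + 1, v.2) ∧ ¬(s (v.1, v.2 - 1) ↔ s v)) ∨
    (w = (v.1, v.2 + 1) ∧ ¬(s (v.1 - 1, v.2) ↔ s v))

/-- The graph formed by the edges on the boundary of the union of the squares in `s`. -/
def BoundaryAdj (s : ℤ × ℤ → Prop) (v w : ℤ × ℤ) : Prop :=
  IsBoundaryEdge s v w ∨ IsBoundaryEdge s w v

variable {s : ℤ × ℤ → Prop} {n : ℤ}

instance : Std.Symm (BoundaryAdj s) := ⟨fun _ _ => Or.symm⟩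

theorem periodic_int_mul (hs : ∀ i j, s (i + n, j) ↔ s (i, j)) (k i j : ℤ) :
    s (i + n * k, j) ↔ s (i, j) := by
  induction k using Int.induction_on with
  | zero => simp
  | succ k ih => rw [← ih, mul_add, mul_one, ← add_assoc, hs]
  | pred k ih => rw [← ih, ← hs (i + n * (-k - 1)), mul_sub, mul_one, add_assoc, sub_add_cancel]

theorem IsBoundaryEdge.translate (hs : ∀ i j, s (i + n, j) ↔ s (i, j)) (k : ℤ) {v w : ℤ × ℤ}
    (h : IsBoundaryEdge s v w) : IsBoundaryEdge s (v + (n * k, 0)) (w + (n * k, 0)) := by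
  obtain ⟨i, j⟩ := v
  have hs' := periodic_int_mul hs k
  rcases h with ⟨rfl, h⟩ | ⟨rfl, h⟩
  · refine Or.inl ⟨by ext <;> simp; ring, ?_⟩
    simpa [hs'] using h
  · refine Or.inr ⟨by ext <;> simp, ?_⟩
    have : i + n * k - 1 = i - 1 + n * k := by ring
    simpa [hs', this] using h

theorem BoundaryAdj.translate (hs : ∀ i j, s (i + n, j) ↔ s (i, j)) (k : ℤ) {v w : ℤ × ℤ}
    (h : BoundaryAdj s v w) : BoundaryAdj s (v + (n * k, 0)) (w + (n * k, 0)) :=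
  h.imp (·.translate hs k) (·.translate hs k)

/-- There is no function that is constant along the boundary graph of a periodic set of squares
separating the ends of the strip and that increases by one under the period. -/
theorem not_exists_potential (hn : 0 < n) (hs : ∀ i j, s (i + n, j) ↔ s (i, j)) {L : ℤ}
    (hlow : ∀ i j, j < -L → s (i, j)) (hhigh : ∀ i j, L < j → ¬ s (i, j)) {c : ℤ × ℤ → ℤ}
    (hc : ∀ v w, IsBoundaryEdge s v w → c v = c w) : ¬ ∀ i j, c (i + n, j) = c (i, j) + 1 := by
  classical
  intro hper
  set σ : ℤ → ℤ → ℤ := fun i j => if s (i, j) then 1 else 0 with hσ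
  have hσp : ∀ i j, σ (i + n) j = σ i j := fun i j => by simp only [hσ, hs]
  have hσne : ∀ {i j i' j'}, σ i j ≠ σ i' j' → ¬(s (i, j) ↔ s (i', j')) :=
    fun h h' => h (by simp only [hσ, h'])
  set h : ℤ → ℤ → ℤ := fun i j => i - n * c (i, j) with hh
  have hhp : ∀ i j, h (i + n) j = h i j := fun i j => by simp only [hh, hper]; ring
  set A : ℤ → ℤ → ℤ := fun i j => (σ (i - 1) (j - 1) - σ (i - 1) j) * h i j with hA
  set B : ℤ → ℤ → ℤ := fun i j => (σ i (j - 1) - σ (i - 1) (j - 1)) * h i j with hB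
  have hpoint : ∀ i j, σ i (j - 1) - σ i j =
      (A (i + 1) j - A i j) + (B i (j + 1) - B i j) := by
    intro i j
    have h1 : (σ i (j - 1) - σ i j) * (h (i + 1) j - h i j - 1) = 0 := by
      by_cases heq : σ i (j - 1) = σ i j
      · rw [heq]; ring
      · have := hc (i, j) (i + 1, j) (Or.inl ⟨rfl, hσne heq⟩)
        simp only [hh, this]; ring
    have h2 : (σ i j - σ (i - 1) j) * (h i (j + 1) - h i j) = 0 := by
      by_cases heq : σ (i - 1) j = σ i j
      · rw [heq]; ring
      · have := hc (i, j) (i, j + 1) (Or.inr ⟨rfl, hσne heq⟩)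
        simp only [hh, this]; ring
    simp only [hA, hB, add_sub_cancel_right]
    linear_combination -h1 - h2
  obtain ⟨n', rfl⟩ := Int.eq_ofNat_of_zero_le hn.le
  set N := (L + 1).toNat with hN
  have hL : L ≤ N := by omega
  have hLn : ∀ i : ℤ, ∀ j : ℤ, j < -N → σ i j = 1 := fun i j hj => by
    simp [hσ, hlow i j (by omega)]
  have hLp : ∀ i : ℤ, ∀ j : ℤ, (N : ℤ) < j → σ i j = 0 := fun i j hj => by
    simp [hσ, hhigh i j (by omega)]
  set J : ℕ → ℤ := fun l => (l : ℤ) - (N + 1) with hJ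
  have hJs : ∀ l, J (l + 1) = J l + 1 := fun l => by simp only [hJ]; push_cast; ring
  have hsumA : ∀ j, ∑ i ∈ Finset.range n', (A ((i : ℤ) + 1) j - A i j) = 0 := by
    intro j
    have := Finset.sum_range_sub (fun i : ℕ => A i j) n'
    push_cast at this
    rw [this]
    have e1 := hσp (-1) (j - 1)
    have e2 := hσp (-1) j
    have e3 := hhp 0 j
    rw [show (-1 : ℤ) + n' = n' - 1 by ring] at e1 e2
    rw [zero_add] at e3
    simp only [hA, e1, e2, e3, zero_sub, sub_self]
  have hsumB : ∀ i, ∑ l ∈ Finset.range (2 * N + 3), (B i (J l + 1) - B i (J l)) = 0 := by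
    intro i
    have := Finset.sum_range_sub (fun l : ℕ => B i (J l)) (2 * N + 3)
    simp only [← hJs]
    rw [this]
    have e1 : J 0 - 1 < -N := by simp [hJ]
    have e2 : (N : ℤ) < J (2 * N + 3) - 1 := by simp only [hJ]; push_cast; omega
    simp only [hB, hLn _ _ e1, hLp _ _ e2]
    ring
  have hsumσ : ∀ i, ∑ l ∈ Finset.range (2 * N + 3), (σ i (J l - 1) - σ i (J l)) = 1 := by
    intro i
    have := Finset.sum_range_sub' (fun l : ℕ => σ i (J l - 1)) (2 * N + 3)
    have e : ∀ l, J l = J (l + 1) - 1 := fun l => by rw [hJs, add_sub_cancel_right]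
    rw [Finset.sum_congr rfl fun l _ => congrArg (fun j => σ i (J l - 1) - σ i j) (e l), this]
    have e1 : J 0 - 1 < -N := by simp [hJ]
    have e2 : (N : ℤ) < J (2 * N + 3) - 1 := by simp only [hJ]; push_cast; omega
    rw [hLn _ _ e1, hLp _ _ e2, sub_zero]
  have htot : ∑ i ∈ Finset.range n', ∑ l ∈ Finset.range (2 * N + 3),
      (σ i (J l - 1) - σ i (J l)) = 0 := by
    simp only [hpoint, Finset.sum_add_distrib, hsumB, add_zero]
    rw [Finset.sum_comm]
    simp [hsumA]
  simp only [hsumσ, Finset.sum_const, Finset.card_range, mul_one, nsmul_eq_mul] at htot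
  omega

/-- Some boundary path joins a vertex to a different translate of it. -/
theorem exists_reflTransGen_translate (hn : 0 < n) (hs : ∀ i j, s (i + n, j) ↔ s (i, j)) {L : ℤ}
    (hlow : ∀ i j, j < -L → s (i, j)) (hhigh : ∀ i j, L < j → ¬ s (i, j)) :
    ∃ v k, k ≠ 0 ∧ Relation.ReflTransGen (BoundaryAdj s) v (v + (n * k, 0)) := by
  by_contra! hno
  set R := Relation.ReflTransGen (BoundaryAdj s) with hR
  have hsymm : ∀ {v w}, R v w → R w v := fun h => Relation.ReflTransGen.stdSymm.symm _ _ h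
  have htrans : ∀ {v w} (k : ℤ), R v w → R (v + (n * k, 0)) (w + (n * k, 0)) := fun k h =>
    h.lift (· + (n * k, 0)) fun _ _ h => h.translate hs k
  have hadd : ∀ (v : ℤ × ℤ) (k l : ℤ), v + (n * k, 0) + (n * l, 0) = v + (n * (k + l), 0) := by
    intro v k l
    ext <;> simp; ring
  have hz : ∀ v : ℤ × ℤ, v + (n * 0, 0) = v := fun v => by ext <;> simp
  let S : Setoid (ℤ × ℤ) :=
    { r := fun v w => ∃ k : ℤ, R v (w + (n * k, 0))
      iseqv :=
        { refl := fun v => ⟨0, (hz v).symm ▸ Relation.ReflTransGen.refl⟩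
          symm := by
            rintro v w ⟨k, h⟩
            refine ⟨-k, hsymm ?_⟩
            have := htrans (-k) h
            rwa [hadd, add_neg_cancel, hz] at this
          trans := by
            rintro u v w ⟨k, h⟩ ⟨l, h'⟩
            refine ⟨l + k, h.trans ?_⟩
            rw [← hadd]
            exact htrans k h' } }
  have huniq : ∀ {v w : ℤ × ℤ} {k l : ℤ}, R v (w + (n * k, 0)) → R v (w + (n * l, 0)) → k = l := by
    intro v w k l h h'
    by_contra hkl
    have := (hsymm h).trans h'
    refine hno (w + (n * k, 0)) (l - k) (sub_ne_zero.2 (Ne.symm hkl)) ?_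
    rwa [hadd, add_sub_cancel]
  choose c hc using fun v : ℤ × ℤ => S.symm (Quotient.mk_out (s := S) v)
  have hout : ∀ {v w : ℤ × ℤ} (k : ℤ), R v (w + (n * k, 0)) →
      (⟦v⟧ : Quotient S).out = (⟦w⟧ : Quotient S).out := fun k h =>
    congrArg Quotient.out (Quotient.sound ⟨k, h⟩)
  refine not_exists_potential hn hs hlow hhigh (c := c) (fun v w hvw => ?_) fun i j => ?_
  · have h : R v w := Relation.ReflTransGen.single (Or.inl hvw)
    have ho := hout (v := v) (w := w) 0 (by rwa [hz])
    have h1 := hc w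
    rw [← ho] at h1
    exact huniq (hc v) (h.trans h1)
  · have e : ((i + n, j) : ℤ × ℤ) = (i, j) + (n * 1, 0) := by ext <;> simp
    have ho := hout (v := (i + n, j)) (w := (i, j)) 1 (e ▸ Relation.ReflTransGen.refl)
    have h1 := hc (i + n, j)
    rw [ho] at h1
    refine huniq h1 ?_
    rw [e, ← hadd]
    exact htrans 1 (hc (i, j))

theorem exists_walk_of_reflTransGen {α : Type*} {r : α → α → Prop} {a b : α}
    (h : Relation.ReflTransGen r a b) :
    ∃ (m : ℕ) (f : ℕ → α), f 0 = a ∧ f m = b ∧ ∀ i < m, r (f i) (f (i + 1)) := by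
  induction h using Relation.ReflTransGen.head_induction_on with
  | refl => exact ⟨0, fun _ => b, rfl, rfl, by simp⟩
  | @head a c hac _ ih =>
    obtain ⟨m, f, h0, hm, hf⟩ := ih
    refine ⟨m + 1, fun i => Nat.casesOn i a f, rfl, hm, fun i hi => ?_⟩
    cases i with
    | zero =>
      change r a (f 0)
      rwa [h0]
    | succ i => exact hf i (by omega)

/-- A periodic boundary path that is simple modulo the period. -/
theorem exists_periodic_boundary_path (hn : 3 ≤ n) (hs : ∀ i j, s (i + n, j) ↔ s (i, j)) {L : ℤ}
    (hlow : ∀ i j, j < -L → s (i, j)) (hhigh : ∀ i j, L < j → ¬ s (i, j)) :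
    ∃ (F : ℤ → ℤ × ℤ) (m k : ℤ), 3 ≤ m ∧ k ≠ 0 ∧ (∀ i, BoundaryAdj s (F i) (F (i + 1))) ∧
      (∀ i, F (i + m) = F i + (n * k, 0)) ∧
      ∀ i i' c, F i = F i' + (n * c, 0) → m ∣ i - i' := by
  classical
  have hex : ∃ (m : ℕ) (f : ℕ → ℤ × ℤ) (k : ℤ), k ≠ 0 ∧ f m = f 0 + (n * k, 0) ∧
      ∀ i < m, BoundaryAdj s (f i) (f (i + 1)) := by
    obtain ⟨v, k, hk, h⟩ := exists_reflTransGen_translate (by omega) hs hlow hhigh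
    obtain ⟨m, f, h0, hm, hf⟩ := exists_walk_of_reflTransGen h
    exact ⟨m, f, k, hk, by rw [hm, h0], hf⟩
  set m := Nat.find hex with hmdef
  obtain ⟨f, k, hk, hfm, hf⟩ := Nat.find_spec hex
  have hmin : ∀ (m' : ℕ) (f : ℕ → ℤ × ℤ) (k : ℤ), k ≠ 0 → f m' = f 0 + (n * k, 0) →
      (∀ i < m', BoundaryAdj s (f i) (f (i + 1))) → m ≤ m' :=
    fun m' f k h1 h2 h3 => Nat.find_min' hex ⟨f, k, h1, h2, h3⟩
  rw [← hmdef] at hfm hf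
  have hm3 : 3 ≤ m := by
    have hb : ∀ i ≤ m, |(f i).1 - (f 0).1| ≤ i := by
      intro i
      induction i with
      | zero => simp
      | succ i ih =>
        intro hi
        have h1 := ih (by omega)
        have h2 : |(f (i + 1)).1 - (f i).1| ≤ 1 := by
          rcases hf i (by omega) with (⟨h, -⟩ | ⟨h, -⟩) | (⟨h, -⟩ | ⟨h, -⟩) <;> rw [h] <;> simp
        have := abs_sub_le (f (i + 1)).1 (f i).1 (f 0).1
        push_cast
        omega
    have h1 := hb m le_rfl
    rw [hfm] at h1
    simp only [Prod.fst_add, add_sub_cancel_left, abs_mul] at h1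
    have h2 := Int.one_le_abs hk
    have h3 : n ≤ |n| := le_abs_self n
    have : n ≤ |n| * |k| := by nlinarith
    omega
  have hinj : ∀ i i' : ℕ, i < i' → i' < m → ∀ c, f i' ≠ f i + (n * c, 0) := by
    intro i i' hii hi' c h
    by_cases hc : c = 0
    · have hfi : f i' = f i := by rw [h, hc]; ext <;> simp
      have := hmin (m - (i' - i)) (fun t => if t ≤ i then f t else f (t + (i' - i))) k hk (by
        rw [if_neg (by omega), if_pos (Nat.zero_le i), ← hfm]
        congr 1; omega) fun t ht => by
          rcases lt_trichotomy t i with hti | rfl | hti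
          · rw [if_pos (by omega), if_pos (by omega)]
            exact hf t (by omega)
          · rw [if_pos le_rfl, if_neg (by omega), ← hfi,
              show t + 1 + (i' - t) = i' + 1 by omega]
            exact hf i' hi'
          · rw [if_neg (by omega), if_neg (by omega),
              show t + 1 + (i' - i) = t + (i' - i) + 1 by omega]
            exact hf _ (by omega)
      omega
    · have := hmin (i' - i) (fun t => f (i + t)) c hc (by
        simp only [Nat.add_sub_cancel' hii.le, h, add_zero]) fun t ht => hf (i + t) (by omega)
      omega
  have hmpos : (0 : ℤ) < m := by omega
  set F : ℤ → ℤ × ℤ := fun i => f (i % m).toNat + (n * (k * (i / m)), 0) with hF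
  have hFper : ∀ i q : ℤ, F (i + m * q) = F i + (n * (k * q), 0) := by
    intro i q
    simp only [hF, Int.add_mul_emod_self_left, Int.add_mul_ediv_left _ _ hmpos.ne']
    ext <;> simp; ring
  have hFf : ∀ t : ℕ, t ≤ m → F t = f t := by
    intro t ht
    rcases ht.lt_or_eq with ht | rfl
    · simp only [hF]
      rw [Int.emod_eq_of_lt (by omega) (by omega), Int.ediv_eq_zero_of_lt (by omega) (by omega)]
      ext <;> simp
    · rw [hfm]
      simp only [hF, Int.emod_self, Int.ediv_self hmpos.ne']
      simp
  have hdecomp : ∀ i : ℤ, ∃ (t : ℕ) (q : ℤ), t < m ∧ i = t + m * q := fun i =>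
    ⟨(i % m).toNat, i / m, by have := Int.emod_lt_of_pos i hmpos; omega, by
      rw [Int.toNat_of_nonneg (Int.emod_nonneg _ hmpos.ne'), Int.emod_add_mul_ediv]⟩
  refine ⟨F, m, k, by exact_mod_cast hm3, hk, fun i => ?_, fun i => ?_, fun i i' c h => ?_⟩
  · obtain ⟨t, q, ht, rfl⟩ := hdecomp i
    have e : (t : ℤ) + m * q + 1 = ((t + 1 : ℕ) : ℤ) + m * q := by push_cast; ring
    rw [e, hFper, hFper, hFf t ht.le, hFf (t + 1) ht]
    exact (hf t ht).translate hs _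
  · simpa using hFper i 1
  · obtain ⟨t, q, ht, rfl⟩ := hdecomp i
    obtain ⟨t', q', ht', rfl⟩ := hdecomp i'
    rw [hFper, hFper, hFf t ht.le, hFf t' ht'.le] at h
    have h1 : f t = f t' + (n * (c + k * q' - k * q), 0) := by
      rw [Prod.ext_iff] at h ⊢
      simp only [Prod.fst_add, Prod.snd_add] at h ⊢
      exact ⟨by linear_combination h.1, by linear_combination h.2⟩
    have : t = t' := by
      rcases lt_trichotomy t t' with hlt | heq | hlt
      · refine absurd ?_ (hinj t t' hlt ht' (-(c + k * q' - k * q)))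
        rw [h1]
        ext
        · simp; ring
        · simp
      · exact heq
      · exact absurd h1 (hinj t' t hlt ht _)
    subst this
    exact ⟨q - q', by ring⟩

end Grid

/-- A curve in the plane that is equivariant, injective modulo integer translations and winds
around the annulus projects to an essential simple loop. -/
theorem isEssentialSimpleLoop_of_equivariant {δ : ℝ → ℝ × ℝ} (hδ : Continuous δ) {k : ℤ}
    (hk : k ≠ 0) (hper : ∀ t, δ (t + 1) = δ t + ((k : ℝ), 0))
    (hinj : ∀ t t', τ (δ t) = τ (δ t') → ∃ q : ℤ, t - t' = q) :
    IsEssentialSimpleLoop (range (τ ∘ δ)) := by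
  have hp : Periodic (τ ∘ δ) 1 := fun t => by
    simp only [comp_apply, hper, τ, Prod.fst_add, Prod.snd_add, add_zero, AddCircle.coe_add]
    rw [Prod.mk.injEq]
    refine ⟨add_eq_left.2 ((AddCircle.coe_eq_zero_iff 1).2 ⟨k, by simp⟩), rfl⟩
  have hquot : IsQuotientMap ((↑) : ℝ → 𝕊) := QuotientAddGroup.isQuotientMap_mk _
  set γ : 𝕊 → 𝔸 := hp.lift with hγdef
  have hγτ : ∀ t : ℝ, γ t = τ (δ t) := hp.lift_coe
  have hγ : Continuous γ := hquot.continuous_iff.2 (continuous_τ.comp hδ)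
  have hrange : range (τ ∘ δ) = range γ := by
    ext p
    constructor
    · rintro ⟨t, rfl⟩
      exact ⟨t, hγτ t⟩
    · rintro ⟨x, rfl⟩
      obtain ⟨t, rfl⟩ := hquot.surjective x
      exact ⟨t, (hγτ t).symm⟩
  have hγi : Injective γ := by
    intro x x' h
    obtain ⟨t, rfl⟩ := hquot.surjective x
    obtain ⟨t', rfl⟩ := hquot.surjective x'
    rw [hγτ, hγτ] at h
    obtain ⟨q, hq⟩ := hinj t t' h
    rw [← sub_eq_zero, ← AddCircle.coe_sub, hq]
    exact (AddCircle.coe_eq_zero_iff 1).2 ⟨q, by simp⟩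
  refine ⟨⟨γ, hγ, hγi, hrange⟩, ?_⟩
  rw [hrange]
  refine isEssentialContinuum_range hγ hk ?_
  set g : ℝ → ℂ := fun t => 2 * Real.pi * Complex.I * ((δ t).1 - k * t : ℝ) + (δ t).2 with hg
  have hgp : Periodic g 1 := fun t => by
    simp only [hg, hper, Prod.fst_add, Prod.snd_add, add_zero]
    push_cast
    ring
  refine ⟨hgp.lift, hquot.continuous_iff.2 (show Continuous g by fun_prop), fun x => ?_⟩
  obtain ⟨t, rfl⟩ := hquot.surjective x
  have : hgp.lift (t : 𝕊) = g t := hgp.lift_coe t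
  rw [this, comp_apply, hγτ, annExp, fourier_coe_one]
  simp only [τ, hg]
  rw [fourier_coe_one, ← Complex.exp_add, ← Complex.exp_add]
  congr 1
  push_cast
  ring

/-- The piecewise linear curve in the plane with vertices `F i`. -/
def polyline (F : ℤ → ℤ × ℤ) (t : ℝ) : ℝ × ℝ :=
  (AffineMap.lineMap ((F ⌊t⌋).1 : ℝ) ((F (⌊t⌋ + 1)).1 : ℝ) (Int.fract t),
    AffineMap.lineMap ((F ⌊t⌋).2 : ℝ) ((F (⌊t⌋ + 1)).2 : ℝ) (Int.fract t))

theorem polyline_of_mem_Icc (F : ℤ → ℤ × ℤ) {i : ℤ} {t : ℝ} (ht : t ∈ Icc (i : ℝ) (i + 1)) :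
    polyline F t = (AffineMap.lineMap ((F i).1 : ℝ) ((F (i + 1)).1 : ℝ) (t - i),
      AffineMap.lineMap ((F i).2 : ℝ) ((F (i + 1)).2 : ℝ) (t - i)) := by
  rcases ht.2.lt_or_eq with h | rfl
  · have : ⌊t⌋ = i := Int.floor_eq_iff.2 ⟨ht.1, h⟩
    simp only [polyline, this, Int.fract]
  · have : ⌊(i : ℝ) + 1⌋ = i + 1 := by simp
    simp only [polyline, this, Int.fract]
    simp

theorem continuous_polyline (F : ℤ → ℤ × ℤ) : Continuous (polyline F) := by
  refine LocallyFinite.continuous (f := fun i : ℤ => Icc (i : ℝ) (i + 1)) (fun x => ?_)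
    (eq_univ_of_forall fun t => mem_iUnion.2
      ⟨⌊t⌋, Int.floor_le t, (Int.lt_floor_add_one t).le⟩) (fun i => isClosed_Icc) fun i => ?_
  · refine ⟨Ioo (x - 1) (x + 1), Ioo_mem_nhds (by linarith) (by linarith),
      (finite_Icc (⌊x⌋ - 2) (⌊x⌋ + 2)).subset ?_⟩
    rintro i ⟨t, ⟨h1, h2⟩, h3, h4⟩
    have h5 := Int.floor_le x
    have h6 := Int.lt_floor_add_one x
    have h7 : (⌊x⌋ : ℝ) - 2 ≤ i := by linarith
    have h8 : (i : ℝ) ≤ ⌊x⌋ + 2 := by linarith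
    exact ⟨by exact_mod_cast h7, by exact_mod_cast h8⟩
  · refine ContinuousOn.congr (f := fun t : ℝ =>
      ((AffineMap.lineMap ((F i).1 : ℝ) ((F (i + 1)).1 : ℝ) (t - i) : ℝ),
        (AffineMap.lineMap ((F i).2 : ℝ) ((F (i + 1)).2 : ℝ) (t - i) : ℝ))) ?_
      fun t ht => polyline_of_mem_Icc F ht
    simp only [AffineMap.lineMap_apply_ring]
    fun_prop

/-- `v` and `w` are the endpoints of an edge of the integer grid. -/
def GridAdj (v w : ℤ × ℤ) : Prop :=
  w = (v.1 + 1, v.2) ∨ w = (v.1, v.2 + 1) ∨ v = (w.1 + 1, w.2) ∨ v = (w.1, w.2 + 1)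

theorem GridAdj.eq_or_eq {v w v' w' : ℤ × ℤ} (h : GridAdj v w) (h' : GridAdj v' w') {r r' : ℝ}
    (hr : r ∈ Ico (0 : ℝ) 1) (hr' : r' ∈ Ico (0 : ℝ) 1)
    (h1 : AffineMap.lineMap (v.1 : ℝ) (w.1 : ℝ) r = AffineMap.lineMap (v'.1 : ℝ) (w'.1 : ℝ) r')
    (h2 : AffineMap.lineMap (v.2 : ℝ) (w.2 : ℝ) r = AffineMap.lineMap (v'.2 : ℝ) (w'.2 : ℝ) r') :
    (v = v' ∧ r = r') ∨ (w = v' ∧ v = w') := by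
  have hdir : ∀ {v w : ℤ × ℤ}, GridAdj v w → ∃ e f : ℤ, w = (v.1 + e, v.2 + f) ∧
      ((e = 1 ∧ f = 0) ∨ (e = -1 ∧ f = 0) ∨ (e = 0 ∧ f = 1) ∨ (e = 0 ∧ f = -1)) := by
    rintro v w h
    refine ⟨w.1 - v.1, w.2 - v.2, by ext <;> simp, ?_⟩
    rcases h with h | h | h | h <;> rw [Prod.ext_iff] at h <;> simp only at h <;> omega
  have hclose : ∀ {a a' e e' : ℤ}, |(e : ℝ)| ≤ 1 → |(e' : ℝ)| ≤ 1 →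
      (a : ℝ) + e * r = a' + e' * r' → a = a' - 1 ∨ a = a' ∨ a = a' + 1 := by
    intro a a' e e' he he' h
    have h3 : |(e : ℝ) * r| < 1 := by
      rw [abs_mul, abs_of_nonneg hr.1]
      exact (mul_le_of_le_one_left hr.1 he).trans_lt hr.2
    have h4 : |(e' : ℝ) * r'| < 1 := by
      rw [abs_mul, abs_of_nonneg hr'.1]
      exact (mul_le_of_le_one_left hr'.1 he').trans_lt hr'.2
    rw [abs_lt] at h3 h4
    have h5 : (a : ℝ) < a' + 2 := by linarith
    have h6 : (a' : ℝ) < a + 2 := by linarith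
    norm_cast at h5 h6
    omega
  obtain ⟨hr0, hr1⟩ := id hr
  obtain ⟨hr0', hr1'⟩ := id hr'
  obtain ⟨a, b⟩ := v
  obtain ⟨a', b'⟩ := v'
  obtain ⟨e, f, rfl, hef⟩ := hdir h
  obtain ⟨e', f', rfl, hef'⟩ := hdir h'
  simp only [AffineMap.lineMap_apply_ring, Int.cast_add, Prod.mk.injEq] at h1 h2 ⊢
  have ha : a = a' - 1 ∨ a = a' ∨ a = a' + 1 := by
    refine hclose (e := e) (e' := e') ?_ ?_ (by linear_combination h1)
    · rcases hef with h | h | h | h <;> simp [h.1]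
    · rcases hef' with h | h | h | h <;> simp [h.1]
  have hb : b = b' - 1 ∨ b = b' ∨ b = b' + 1 := by
    refine hclose (e := f) (e' := f') ?_ ?_ (by linear_combination h2)
    · rcases hef with h | h | h | h <;> simp [h.2]
    · rcases hef' with h | h | h | h <;> simp [h.2]
  rcases ha with rfl | rfl | rfl <;> rcases hb with rfl | rfl | rfl <;>
  rcases hef with ⟨rfl, rfl⟩ | ⟨rfl, rfl⟩ | ⟨rfl, rfl⟩ | ⟨rfl, rfl⟩ <;>
  rcases hef' with ⟨rfl, rfl⟩ | ⟨rfl, rfl⟩ | ⟨rfl, rfl⟩ | ⟨rfl, rfl⟩ <;>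
  push_cast at h1 h2 <;>
  first
  | (exfalso; linarith)
  | exact Or.inl ⟨⟨rfl, rfl⟩, by linarith⟩
  | exact Or.inr ⟨⟨by omega, by omega⟩, ⟨by omega, by omega⟩⟩

/-- The loop traced out by a periodic path in the grid `(1/n) ℤ²`. -/
theorem isEssentialSimpleLoop_polyline {F : ℤ → ℤ × ℤ} {n m k : ℤ} (hn : 0 < n) (hm : 3 ≤ m)
    (hk : k ≠ 0) (hF : ∀ i, GridAdj (F i) (F (i + 1))) (hper : ∀ i, F (i + m) = F i + (n * k, 0))
    (hinj : ∀ i i' c, F i = F i' + (n * c, 0) → m ∣ i - i') :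
    IsEssentialSimpleLoop (range (τ ∘ fun t : ℝ => (n : ℝ)⁻¹ • polyline F (m * t))) := by
  have hn0 : (n : ℝ) ≠ 0 := by exact_mod_cast hn.ne'
  have hm0 : (m : ℝ) ≠ 0 := by
    have : m ≠ 0 := by omega
    exact_mod_cast this
  refine isEssentialSimpleLoop_of_equivariant (k := k)
    (by have := continuous_polyline F; fun_prop) hk (fun t => ?_) fun t t' h => ?_
  · have h1 : (m : ℝ) * (t + 1) = m * t + (m : ℤ) := by ring
    have h2 : F (⌊m * t⌋ + m + 1) = F (⌊m * t⌋ + 1) + (n * k, 0) := by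
      rw [← hper]; ring_nf
    simp only [polyline, h1, Int.floor_add_intCast, Int.fract_add_intCast, hper, h2,
      AffineMap.lineMap_apply_ring, Prod.smul_mk, Prod.mk_add_mk, Prod.fst_add, Prod.snd_add,
      smul_eq_mul, add_zero]
    push_cast
    ext
    · simp only
      field_simp
      ring
    · rfl
  · simp only [τ, Prod.smul_fst, Prod.smul_snd, smul_eq_mul, Prod.mk.injEq] at h
    obtain ⟨h1, h2⟩ := h
    rw [← sub_eq_zero, ← AddCircle.coe_sub, AddCircle.coe_eq_zero_iff] at h1
    obtain ⟨c, hc⟩ := h1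
    have h3 := mul_left_cancel₀ (inv_ne_zero hn0) h2
    have h4 : (polyline F (m * t)).1 = (polyline F (m * t')).1 + n * c := by
      rw [zsmul_eq_mul, mul_one, ← mul_sub] at hc
      rw [hc]
      field_simp
      ring
    simp only [polyline] at h3 h4
    have hadj : GridAdj (F ⌊m * t'⌋ + (n * c, 0)) (F (⌊m * t'⌋ + 1) + (n * c, 0)) := by
      have := hF ⌊m * t'⌋
      simp only [GridAdj, Prod.ext_iff, Prod.fst_add, Prod.snd_add] at this ⊢
      omega
    rcases (hF ⌊m * t⌋).eq_or_eq hadj ⟨Int.fract_nonneg _, Int.fract_lt_one _⟩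
      ⟨Int.fract_nonneg (m * t'), Int.fract_lt_one _⟩ (by
        rw [h4]
        simp only [AffineMap.lineMap_apply_ring, Prod.fst_add]
        push_cast
        ring) (by
        rw [h3]
        simp only [Prod.snd_add, add_zero]) with ⟨h5, h6⟩ | ⟨h5, h6⟩
    · obtain ⟨q, hq⟩ := hinj _ _ _ h5
      refine ⟨q, mul_left_cancel₀ hm0 ?_⟩
      have h7 := Int.floor_add_fract (m * t)
      have h8 := Int.floor_add_fract (m * t')
      have h9 : ((⌊m * t⌋ : ℤ) : ℝ) - ⌊m * t'⌋ = m * q := by exact_mod_cast hq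
      linear_combination -h7 + h8 + h6 + h9
    · have h7 := hinj _ _ _ h5
      have h8 := hinj _ _ _ h6
      have h9 := Int.le_of_dvd (by norm_num) ((by ring :
        ⌊m * t⌋ + 1 - ⌊m * t'⌋ - (⌊m * t⌋ - (⌊m * t'⌋ + 1)) = 2) ▸ h7.sub h8)
      omega

theorem BoundaryAdj.gridAdj {s : ℤ × ℤ → Prop} {v w : ℤ × ℤ} (h : BoundaryAdj s v w) :
    GridAdj v w := by
  rcases h with (⟨h, -⟩ | ⟨h, -⟩) | (⟨h, -⟩ | ⟨h, -⟩) <;> simp [GridAdj, h]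

theorem BoundaryAdj.exists_of_lineMap {s : ℤ × ℤ → Prop} {v w : ℤ × ℤ} (h : BoundaryAdj s v w)
    {r x y : ℝ} (hr : r ∈ Icc (0 : ℝ) 1) (hx : x = AffineMap.lineMap (v.1 : ℝ) (w.1 : ℝ) r)
    (hy : y = AffineMap.lineMap (v.2 : ℝ) (w.2 : ℝ) r) :
    ∃ i j : ℤ, (y = j ∧ x ∈ Icc (i : ℝ) (i + 1) ∧ ¬(s (i, j - 1) ↔ s (i, j))) ∨
      (x = i ∧ y ∈ Icc (j : ℝ) (j + 1) ∧ ¬(s (i - 1, j) ↔ s (i, j))) := by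
  obtain ⟨a, b⟩ := v
  obtain ⟨c, d⟩ := w
  obtain ⟨hr0, hr1⟩ := hr
  simp only [AffineMap.lineMap_apply_ring] at hx hy
  simp only [BoundaryAdj, IsBoundaryEdge, Prod.mk.injEq] at h
  rcases h with (⟨⟨rfl, rfl⟩, h⟩ | ⟨⟨rfl, rfl⟩, h⟩) | (⟨⟨rfl, rfl⟩, h⟩ | ⟨⟨rfl, rfl⟩, h⟩) <;>
    push_cast at hx hy
  · exact ⟨_, _, Or.inl ⟨by linarith, ⟨by linarith, by linarith⟩, h⟩⟩
  · exact ⟨_, _, Or.inr ⟨by linarith, ⟨by linarith, by linarith⟩, h⟩⟩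
  · exact ⟨_, _, Or.inl ⟨by linarith, ⟨by linarith, by linarith⟩, h⟩⟩
  · exact ⟨_, _, Or.inr ⟨by linarith, ⟨by linarith, by linarith⟩, h⟩⟩

theorem IsPreconnected.exists_mem_frontier {α : Type*} [TopologicalSpace α] {S Z : Set α}
    (hS : IsPreconnected S) (h : (S ∩ Z).Nonempty) (h' : (S ∩ Zᶜ).Nonempty) :
    (S ∩ frontier Z).Nonempty := by
  by_contra hne
  rw [not_nonempty_iff_eq_empty, ← disjoint_iff_inter_eq_empty, ← subset_compl_iff_disjoint_right,
    compl_frontier_eq_union_interior] at hne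
  obtain ⟨p, hpS, hp⟩ := h
  obtain ⟨q, hqS, hq⟩ := h'
  obtain ⟨r, -, hr, hr'⟩ := hS _ _ isOpen_interior isOpen_interior hne
    ⟨p, hpS, (hne hpS).resolve_right fun h => interior_subset h hp⟩
    ⟨q, hqS, (hne hqS).resolve_left fun h => hq (interior_subset h)⟩
  exact interior_subset hr' (interior_subset hr)

theorem exists_mem_frontier {α : Type*} [TopologicalSpace α] {X Y : Set α} (hX : IsClosed X)
    (hd : Disjoint X Y) {γ : ℝ → α} (hγ : Continuous γ) (h0 : γ 0 ∈ X) (h1 : γ 1 ∈ Y) :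
    ∃ t₁ t₂, 0 ≤ t₁ ∧ t₁ ≤ t₂ ∧ t₂ ≤ 1 ∧ γ t₁ ∈ frontier X ∧ γ t₂ ∈ frontier Y := by
  have key : ∀ {a b : ℝ} {Z : Set α}, a ≤ b → ((γ a ∈ Z ∧ γ b ∉ Z) ∨ (γ a ∉ Z ∧ γ b ∈ Z)) →
      ∃ t ∈ Icc a b, γ t ∈ frontier Z := by
    intro a b Z hab h
    have hpre := isPreconnected_Icc.image γ (hγ.continuousOn (s := Icc a b))
    have ha := mem_image_of_mem γ (left_mem_Icc.2 hab)
    have hb := mem_image_of_mem γ (right_mem_Icc.2 hab)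
    have : (γ '' Icc a b ∩ frontier Z).Nonempty := by
      rcases h with h | h
      · exact hpre.exists_mem_frontier ⟨_, ha, h.1⟩ ⟨_, hb, h.2⟩
      · exact hpre.exists_mem_frontier ⟨_, hb, h.2⟩ ⟨_, ha, h.1⟩
    obtain ⟨_, ⟨t, ht, rfl⟩, hZ⟩ := this
    exact ⟨t, ht, hZ⟩
  obtain ⟨t₁, ht₁, hX₁⟩ := key zero_le_one (Or.inl ⟨h0, Set.disjoint_right.1 hd h1⟩)
  obtain ⟨t₂, ht₂, hY₂⟩ := key ht₁.2
    (Or.inr ⟨Set.disjoint_left.1 hd (hX.frontier_subset hX₁), h1⟩)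
  exact ⟨t₁, t₂, ht₁.1, ht₂.1, ht₂.2, hX₁, hY₂⟩

theorem dist_τ_le (p q : ℝ × ℝ) : dist (τ p) (τ q) ≤ max |p.1 - q.1| |p.2 - q.2| := by
  rw [Prod.dist_eq]
  refine max_le_max ?_ (Real.dist_eq _ _).le
  rw [dist_eq_norm]
  simp only [τ]
  rw [← AddCircle.coe_sub]
  exact QuotientAddGroup.norm_mk_le_norm

/-- A nearly vertical segment from `X` up to `Y` contains points of the frontiers of `X` and `Y`
whose heights differ by at least the distance of the frontiers. -/
theorem exists_height_gap {X Y : Set 𝔸} (hX : IsClosed X) (hd : Disjoint X Y) {w : ℝ}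
    (hsep : ∀ a ∈ frontier X, ∀ b ∈ frontier Y, w ≤ dist a b) {p q : ℝ × ℝ} (hp : τ p ∈ X)
    (hq : τ q ∈ Y) (hpq : |q.1 - p.1| < w) (hle : p.2 ≤ q.2) {c d : ℝ} (hpc : p.1 ∈ Icc c d)
    (hqc : q.1 ∈ Icc c d) :
    ∃ a b : ℝ × ℝ, τ a ∈ frontier X ∧ τ b ∈ frontier Y ∧ b.1 ∈ Icc c d ∧ p.2 ≤ a.2 ∧
      a.2 + w ≤ b.2 ∧ b.2 ≤ q.2 := by
  set σ : ℝ → ℝ × ℝ := fun t => (p.1 + t * (q.1 - p.1), p.2 + t * (q.2 - p.2)) with hσ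
  have h0 : σ 0 = p := by simp [hσ]
  have h1 : σ 1 = q := by simp [hσ]
  obtain ⟨t₁, t₂, ht₁, ht, ht₂, hX₁, hY₂⟩ := exists_mem_frontier (γ := τ ∘ σ) hX hd
    (continuous_τ.comp (by fun_prop)) (by rwa [comp_apply, h0]) (by rwa [comp_apply, h1])
  refine ⟨σ t₁, σ t₂, hX₁, hY₂, ⟨?_, ?_⟩, ?_, ?_, ?_⟩
  · simp only [hσ]
    nlinarith [hpc.1, hqc.1]
  · simp only [hσ]
    nlinarith [hpc.2, hqc.2]
  · simp only [hσ]
    nlinarith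
  · have hdist := (hsep _ hX₁ _ hY₂).trans (dist_τ_le _ _)
    have h2 : |(σ t₁).1 - (σ t₂).1| < w := by
      have : (σ t₁).1 - (σ t₂).1 = (t₁ - t₂) * (q.1 - p.1) := by simp only [hσ]; ring
      rw [this, abs_mul]
      refine (mul_le_of_le_one_left (abs_nonneg _) ?_).trans_lt hpq
      rw [abs_le]
      constructor <;> linarith
    have h3 : |(σ t₁).2 - (σ t₂).2| = (σ t₂).2 - (σ t₁).2 := by
      rw [abs_sub_comm, abs_of_nonneg]
      simp only [hσ]
      nlinarith
    rcases le_max_iff.1 hdist with h | h <;> linarith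
  · simp only [hσ]
    nlinarith

/-- The closed cell of the grid `(1/n) ℤ²` with index `v`. -/
def cell (n : ℕ) (v : ℤ × ℤ) : Set (ℝ × ℝ) :=
  {p | n * p.1 ∈ Icc (v.1 : ℝ) (v.1 + 1) ∧ n * p.2 ∈ Icc (v.2 : ℝ) (v.2 + 1)}

/-- The cells lying on the lower side: going down from such a cell, one meets a cell touching `X`
before meeting one touching `Y`. -/
def lowerSide (n : ℕ) (X Y : Set 𝔸) (v : ℤ × ℤ) : Prop :=
  ∃ j ≤ v.2, (cell n (v.1, j) ∩ τ ⁻¹' X).Nonempty ∧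
    ∀ j' ∈ Ioc j v.2, ¬ (cell n (v.1, j') ∩ τ ⁻¹' Y).Nonempty

section LowerSide

variable {n : ℕ} {X Y : Set 𝔸}

theorem lowerSide_of_nonempty {v : ℤ × ℤ} (h : (cell n v ∩ τ ⁻¹' X).Nonempty) :
    lowerSide n X Y v :=
  ⟨v.2, le_rfl, h, fun _ hj => absurd hj.1 (not_lt.2 hj.2)⟩

theorem nonempty_of_lowerSide {i j : ℤ} (h : ¬ lowerSide n X Y (i, j - 1))
    (h' : lowerSide n X Y (i, j)) : (cell n (i, j) ∩ τ ⁻¹' X).Nonempty := by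
  obtain ⟨l, hl, hX, hY⟩ := h'
  rcases hl.lt_or_eq with hlt | heq
  · exact absurd ⟨l, Int.le_sub_one_of_lt hlt, hX, fun l' hl' =>
      hY l' ⟨hl'.1, hl'.2.trans (sub_one_lt j).le⟩⟩ h
  · simpa only [heq] using hX

theorem nonempty_of_not_lowerSide {i j : ℤ} (h : lowerSide n X Y (i, j - 1))
    (h' : ¬ lowerSide n X Y (i, j)) : (cell n (i, j) ∩ τ ⁻¹' Y).Nonempty := by
  by_contra hj
  obtain ⟨l, hl, hX, hY⟩ := h
  refine h' ⟨l, hl.trans (sub_one_lt j).le, hX, fun l' hl' => ?_⟩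
  rcases hl'.2.lt_or_eq with hlt | heq
  · exact hY l' ⟨hl'.1, Int.le_sub_one_of_lt hlt⟩
  · simpa only [heq] using hj

theorem nonempty_cell_translate (Z : Set 𝔸) (i j : ℤ) :
    (cell n (i + n, j) ∩ τ ⁻¹' Z).Nonempty ↔ (cell n (i, j) ∩ τ ⁻¹' Z).Nonempty := by
  have hτ : ∀ (x y : ℝ), τ (x + 1, y) = τ (x, y) := fun x y => by
    simp only [τ]
    rw [AddCircle.coe_add_period]
  constructor
  · rintro ⟨⟨x, y⟩, ⟨hx, hy⟩, hZ⟩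
    refine ⟨(x - 1, y), ⟨?_, hy⟩, ?_⟩
    · simp only [mem_Icc, Int.cast_add, Int.cast_natCast] at hx ⊢
      constructor <;> linarith
    · rwa [mem_preimage, ← hτ, sub_add_cancel]
  · rintro ⟨⟨x, y⟩, ⟨hx, hy⟩, hZ⟩
    refine ⟨(x + 1, y), ⟨?_, hy⟩, ?_⟩
    · simp only [mem_Icc, Int.cast_add, Int.cast_natCast] at hx ⊢
      constructor <;> linarith
    · rwa [mem_preimage, hτ]

theorem lowerSide_translate (i j : ℤ) :
    lowerSide n X Y (i + n, j) ↔ lowerSide n X Y (i, j) := by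
  simp only [lowerSide, nonempty_cell_translate]

theorem not_lowerSide_of_nonempty (hn : 0 < n) (hX : IsClosed X) (hY : IsClosed Y)
    (hd : Disjoint X Y) {w : ℝ} (hnw : (n : ℝ)⁻¹ < w)
    (hsep : ∀ a ∈ frontier X, ∀ b ∈ frontier Y, w ≤ dist a b) {v : ℤ × ℤ}
    (h : (cell n v ∩ τ ⁻¹' Y).Nonempty) : ¬ lowerSide n X Y v := by
  rintro ⟨j, hj, ⟨p, hp, hpX⟩, hY'⟩
  rcases hj.lt_or_eq with hlt | heq
  · exact hY' v.2 ⟨hlt, le_rfl⟩ h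
  subst heq
  obtain ⟨q, hq, hqY⟩ := h
  have hn0 : (0 : ℝ) < n := by exact_mod_cast hn
  have hnw' : 1 < n * w := by rwa [inv_lt_iff_one_lt_mul₀' hn0] at hnw
  have hclose : ∀ {x y c : ℝ}, n * x ∈ Icc c (c + 1) → n * y ∈ Icc c (c + 1) → |y - x| < w := by
    intro x y c hx hy
    refine lt_of_mul_lt_mul_left ?_ hn0.le
    rw [← abs_of_pos hn0, ← abs_mul, abs_of_pos hn0, mul_sub]
    refine lt_of_le_of_lt (abs_le.2 ?_) hnw'
    constructor <;> linarith [hx.1, hx.2, hy.1, hy.2]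
  have h1 := hclose hp.1 hq.1
  have h2 := hclose hp.2 hq.2
  rcases le_total p.2 q.2 with hle | hle
  · obtain ⟨a, b, -, -, -, h3, h4, h5⟩ := exists_height_gap hX hd hsep hpX hqY h1 hle
      (c := min p.1 q.1) (d := max p.1 q.1) ⟨min_le_left _ _, le_max_left _ _⟩
      ⟨min_le_right _ _, le_max_right _ _⟩
    linarith [le_abs_self (q.2 - p.2)]
  · rw [abs_sub_comm] at h1
    obtain ⟨a, b, -, -, -, h3, h4, h5⟩ := exists_height_gap hY hd.symm
      (fun a ha b hb => dist_comm b a ▸ hsep b hb a ha) hqY hpX h1 hle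
      (c := min p.1 q.1) (d := max p.1 q.1) ⟨min_le_right _ _, le_max_right _ _⟩
      ⟨min_le_left _ _, le_max_left _ _⟩
    linarith [neg_abs_le (q.2 - p.2)]

end LowerSide

/-- Climbing a column of the grid, each change of side costs a height of at least `w`. -/
theorem card_mul_le_of_lowerSide {A X Y : Set 𝔸} {n : ℕ} (hn : 0 < n) (hX : IsClosed X)
    (hY : IsClosed Y) (hd : Disjoint X Y) (hXA : frontier X ⊆ A) (hYA : frontier Y ⊆ A) {w : ℝ}
    (hnw : (n : ℝ)⁻¹ < w) (hsep : ∀ a ∈ frontier X, ∀ b ∈ frontier Y, w ≤ dist a b) {H : ℝ}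
    (hH0 : 0 ≤ H) (hH : ∀ p ∈ A, ∀ q ∈ A, q.2 - p.2 ≤ H) {j₀ : ℤ}
    (h0 : (cell n (0, j₀) ∩ τ ⁻¹' X).Nonempty) (l : ℕ) [DecidablePred fun t : ℕ =>
      ¬(lowerSide n X Y (0, j₀ + t) ↔ lowerSide n X Y (0, j₀ + t + 1))] :
    ((Finset.range l).filter fun t : ℕ =>
      ¬(lowerSide n X Y (0, j₀ + t) ↔ lowerSide n X Y (0, j₀ + t + 1))).card * w ≤ H := by
  set cnt : ℕ → ℕ := fun l => ((Finset.range l).filter fun t : ℕ =>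
      ¬(lowerSide n X Y (0, j₀ + t) ↔ lowerSide n X Y (0, j₀ + t + 1))).card with hcnt
  have hn0 : (0 : ℝ) < n := by exact_mod_cast hn
  have hnw' : 1 < n * w := by rwa [inv_lt_iff_one_lt_mul₀' hn0] at hnw
  have hcnt0 : ∀ l : ℕ, (lowerSide n X Y (0, j₀ + l) ↔ lowerSide n X Y (0, j₀ + l + 1)) →
      cnt (l + 1) = cnt l := fun l hl => by
    simp only [hcnt, Finset.range_add_one, Finset.filter_insert]
    rw [if_neg (not_not.2 hl)]
  have hcnt1 : ∀ l : ℕ, ¬(lowerSide n X Y (0, j₀ + l) ↔ lowerSide n X Y (0, j₀ + l + 1)) →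
      cnt (l + 1) = cnt l + 1 := fun l hl => by
    simp only [hcnt, Finset.range_add_one, Finset.filter_insert]
    rw [if_pos hl, Finset.card_insert_of_notMem (by simp)]
  have hgap : ∀ {Z Z' : Set 𝔸} {l : ℕ} {p q : ℝ × ℝ}, IsClosed Z → IsClosed Z' → Disjoint Z Z' →
      frontier Z ⊆ A → frontier Z' ⊆ A → (∀ a ∈ frontier Z, ∀ b ∈ frontier Z', w ≤ dist a b) →
      n * p.1 ∈ Icc (0 : ℝ) 1 → n * p.2 ≤ j₀ + l + 1 → τ p ∈ Z →
      (cnt l = 0 ∨ τ p ∈ A ∧ ∃ q ∈ A, q.2 + cnt l * w ≤ p.2) →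
      q ∈ cell n (0, j₀ + l + 1) → τ q ∈ Z' →
      ∃ b : ℝ × ℝ, n * b.1 ∈ Icc (0 : ℝ) 1 ∧ n * b.2 ≤ j₀ + (l + 1 : ℕ) + 1 ∧ τ b ∈ Z' ∧
        τ b ∈ A ∧ ∃ q ∈ A, q.2 + (cnt l + 1 : ℕ) * w ≤ b.2 := by
    intro Z Z' l p q hZ hZ' hZZ hZA hZA' hs hp1 hp2 hpZ hpA hq hqZ
    obtain ⟨hq1, hq2⟩ := hq
    simp only [Int.cast_zero, zero_add, Int.cast_add, Int.cast_natCast, Int.cast_one] at hq1 hq2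
    have hcol : ∀ x : ℝ, n * x ∈ Icc (0 : ℝ) 1 ↔ x ∈ Icc (0 : ℝ) (n : ℝ)⁻¹ := fun x => by
      simp only [mem_Icc, mul_nonneg_iff_of_pos_left hn0, ← one_div, le_div_iff₀ hn0,
        mul_comm x]
    rw [hcol] at hp1 hq1
    have hle : p.2 ≤ q.2 := le_of_mul_le_mul_left (hp2.trans hq2.1) hn0
    obtain ⟨a, b, ha, hb, hb1, h1, h2, h3⟩ := exists_height_gap hZ hZZ hs hpZ hqZ
      (abs_lt.2 ⟨by linarith [hp1.1, hp1.2, hq1.1, hq1.2], by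
        linarith [hp1.1, hp1.2, hq1.1, hq1.2]⟩) hle hp1 hq1
    refine ⟨b, (hcol _).2 hb1, ?_, hZ'.frontier_subset hb, hZA' hb, ?_⟩
    · refine (mul_le_mul_of_nonneg_left h3 hn0.le).trans (hq2.2.trans ?_)
      push_cast
      linarith
    · rcases hpA with h | ⟨-, r, hr, hrp⟩
      · refine ⟨τ a, hZA ha, ?_⟩
        rw [h]
        simpa [τ] using h2
      · refine ⟨r, hr, ?_⟩
        push_cast
        linarith
  have hmain : ∀ l : ℕ, ∃ p : ℝ × ℝ, n * p.1 ∈ Icc (0 : ℝ) 1 ∧ n * p.2 ≤ j₀ + l + 1 ∧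
      (lowerSide n X Y (0, j₀ + l) → τ p ∈ X) ∧ (¬ lowerSide n X Y (0, j₀ + l) → τ p ∈ Y) ∧
      (cnt l = 0 ∨ τ p ∈ A ∧ ∃ q ∈ A, q.2 + cnt l * w ≤ p.2) := by
    intro l
    induction l with
    | zero =>
      obtain ⟨p, hp, hpX⟩ := h0
      refine ⟨p, by simpa using hp.1, by simpa using hp.2.2, fun _ => hpX, fun h => ?_,
        Or.inl (by simp [hcnt])⟩
      exact absurd (by simpa using lowerSide_of_nonempty ⟨p, hp, hpX⟩) h
    | succ l ih =>
      obtain ⟨p, hp1, hp2, hpX, hpY, hpA⟩ := ih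
      have hcast : j₀ + ((l + 1 : ℕ) : ℤ) = j₀ + l + 1 := by push_cast; ring
      rw [hcast]
      by_cases h : lowerSide n X Y (0, j₀ + l) <;> by_cases h' : lowerSide n X Y (0, j₀ + l + 1)
      · rw [hcnt0 l (iff_of_true h h')]
        exact ⟨p, hp1, hp2.trans (by push_cast; linarith), fun _ => hpX h,
          fun h'' => absurd h' h'', hpA⟩
      · obtain ⟨q, hq, hqY⟩ := nonempty_of_not_lowerSide (by rwa [add_sub_cancel_right]) h'
        rw [hcnt1 l (by tauto)]
        obtain ⟨b, hb1, hb2, hbY, hbA⟩ := hgap hX hY hd hXA hYA hsep hp1 hp2 (hpX h) hpA hq hqY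
        exact ⟨b, hb1, hb2, fun h'' => absurd h'' h', fun _ => hbY, Or.inr hbA⟩
      · obtain ⟨q, hq, hqX⟩ := nonempty_of_lowerSide (by rwa [add_sub_cancel_right]) h'
        rw [hcnt1 l (by tauto)]
        obtain ⟨b, hb1, hb2, hbX, hbA⟩ := hgap hY hX hd.symm hYA hXA
          (fun a ha b hb => dist_comm b a ▸ hsep b hb a ha) hp1 hp2 (hpY h) hpA hq hqX
        exact ⟨b, hb1, hb2, fun _ => hbX, fun h'' => absurd h' h'', Or.inr hbA⟩
      · rw [hcnt0 l (iff_of_false h h')]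
        exact ⟨p, hp1, hp2.trans (by push_cast; linarith), fun h'' => absurd h'' h',
          fun _ => hpY h, hpA⟩
  obtain ⟨p, -, -, -, -, h | ⟨hpA, q, hq, hqp⟩⟩ := hmain l
  · change (cnt l : ℝ) * w ≤ H
    rw [h]
    simpa using hH0
  · change (cnt l : ℝ) * w ≤ H
    have := hH q hq _ hpA
    simp only [τ] at this
    linarith

/-- Between two separated ends there is an essential simple loop meeting some vertical line in
few points. -/
theorem exists_essentialSimpleLoop_card_le {A X Y : Set 𝔸} (hX : IsClosed X) (hY : IsClosed Y)
    (hd : Disjoint X Y) (hXA : frontier X ⊆ A) (hYA : frontier Y ⊆ A) {w : ℝ} (hw : 0 < w)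
    (hsep : ∀ a ∈ frontier X, ∀ b ∈ frontier Y, w ≤ dist a b) {H : ℝ} (hH0 : 0 ≤ H)
    (hH : ∀ p ∈ A, ∀ q ∈ A, q.2 - p.2 ≤ H) {M : ℝ}
    (hM : ∀ p : 𝔸, (p.2 < -M → p ∈ X) ∧ (M < p.2 → p ∈ Y)) (hA : (X ∪ Y)ᶜ ⊆ A) :
    ∃ Γ ⊆ A, IsEssentialSimpleLoop Γ ∧ ∃ (x : ℝ) (S : Finset 𝔸),
      (∀ p ∈ Γ, p.1 = (x : 𝕊) → p ∈ S) ∧ S.card * w ≤ H := by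
  classical
  obtain ⟨n, hn3, hnw⟩ : ∃ n : ℕ, 3 ≤ n ∧ (n : ℝ)⁻¹ < w := by
    obtain ⟨n, hn⟩ := exists_nat_one_div_lt hw
    refine ⟨n + 3, by omega, lt_of_le_of_lt ?_ hn⟩
    rw [← one_div]
    refine one_div_le_one_div_of_le (by positivity) ?_
    push_cast
    linarith
  have hn : 0 < n := by omega
  have hn0 : (0 : ℝ) < n := by exact_mod_cast hn
  obtain ⟨L, hL⟩ := exists_nat_ge (n * M)
  set s := lowerSide n X Y with hs
  have hcorner : ∀ i j : ℤ, ((i : ℝ) / n, (j : ℝ) / n) ∈ cell n (i, j) := fun i j => by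
    simp only [cell, mem_ofPred_eq, mul_div_cancel₀ _ hn0.ne']
    simp
  have hlowX : ∀ i j : ℤ, j < -L → (cell n (i, j) ∩ τ ⁻¹' X).Nonempty := fun i j hj => by
    refine ⟨_, hcorner i j, (hM _).1 ?_⟩
    have : (j : ℝ) < -L := by exact_mod_cast hj
    simp only [τ]
    rw [div_lt_iff₀ hn0]
    linarith
  have hhighY : ∀ i j : ℤ, L < j → (cell n (i, j) ∩ τ ⁻¹' Y).Nonempty := fun i j hj => by
    refine ⟨_, hcorner i j, (hM _).2 ?_⟩
    have : (L : ℝ) < j := by exact_mod_cast hj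
    simp only [τ]
    rw [lt_div_iff₀ hn0]
    linarith
  have hsX : ∀ {v}, (cell n v ∩ τ ⁻¹' X).Nonempty → s v := lowerSide_of_nonempty
  have hsY : ∀ {v}, (cell n v ∩ τ ⁻¹' Y).Nonempty → ¬ s v :=
    not_lowerSide_of_nonempty hn hX hY hd hnw hsep
  have hlow : ∀ i j : ℤ, j < -L → s (i, j) := fun i j hj => hsX (hlowX i j hj)
  have hhigh : ∀ i j : ℤ, (L : ℤ) < j → ¬ s (i, j) := fun i j hj => hsY (hhighY i j hj)
  have hper : ∀ i j : ℤ, s (i + n, j) ↔ s (i, j) := lowerSide_translate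
  obtain ⟨F, m, k, hm, hk, hF, hFm, hinj⟩ :=
    exists_periodic_boundary_path (by exact_mod_cast hn3) hper hlow hhigh
  have hloop := isEssentialSimpleLoop_polyline (by exact_mod_cast hn) hm hk
    (fun i => (hF i).gridAdj) hFm hinj
  have hpt : ∀ t : ℝ, ∃ z : ℝ × ℝ, ((n : ℤ) : ℝ)⁻¹ • polyline F t = z ∧ ∃ i j : ℤ,
      (n * z.2 = j ∧ n * z.1 ∈ Icc (i : ℝ) (i + 1) ∧ ¬(s (i, j - 1) ↔ s (i, j))) ∨
      (n * z.1 = i ∧ n * z.2 ∈ Icc (j : ℝ) (j + 1) ∧ ¬(s (i - 1, j) ↔ s (i, j))) := by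
    intro t
    refine ⟨_, rfl, (hF ⌊t⌋).exists_of_lineMap
      ⟨Int.fract_nonneg t, (Int.fract_lt_one t).le⟩ ?_ ?_⟩ <;>
    · simp only [Prod.smul_fst, Prod.smul_snd, smul_eq_mul, Int.cast_natCast,
        mul_inv_cancel_left₀ hn0.ne', polyline]
  refine ⟨_, ?_, hloop, (2 * n : ℝ)⁻¹, ((Finset.range (2 * L + 2)).filter fun t : ℕ =>
      ¬(s (0, -L - 1 + t) ↔ s (0, -L - 1 + t + 1))).image
        fun t : ℕ => τ ((2 * n : ℝ)⁻¹, (t - L) / n), ?_, ?_⟩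
  · rintro _ ⟨t, rfl⟩
    obtain ⟨z, hz, i, j, h⟩ := hpt (m * t)
    simp only [comp_apply, hz]
    obtain ⟨v, v', hv, hv', hne⟩ : ∃ v v', z ∈ cell n v ∧ z ∈ cell n v' ∧ ¬ (s v ↔ s v') := by
      rcases h with ⟨h1, h2, h3⟩ | ⟨h1, h2, h3⟩
      · refine ⟨_, _, ⟨h2, ?_⟩, ⟨h2, ?_⟩, h3⟩ <;> simp [h1]
      · refine ⟨_, _, ⟨?_, h2⟩, ⟨?_, h2⟩, h3⟩ <;> simp [h1]
    refine hA fun hXY => hne ?_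
    rcases hXY with h | h
    · exact iff_of_true (hsX ⟨z, hv, h⟩) (hsX ⟨z, hv', h⟩)
    · exact iff_of_false (hsY ⟨z, hv, h⟩) (hsY ⟨z, hv', h⟩)
  · rintro _ ⟨t, rfl⟩ ht
    obtain ⟨z, hz, i, j, h⟩ := hpt (m * t)
    simp only [comp_apply, hz] at ht ⊢
    simp only [τ] at ht
    rw [← sub_eq_zero, ← AddCircle.coe_sub, AddCircle.coe_eq_zero_iff] at ht
    obtain ⟨c, hc⟩ := ht
    rw [zsmul_eq_mul, mul_one] at hc
    have hx : n * z.1 = n * c + 1 / 2 := by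
      rw [hc]
      field_simp
      ring
    rcases h with ⟨h1, h2, h3⟩ | ⟨h1, h2, h3⟩
    · have hi : i = n * c := by
        have h4 : (i : ℝ) < n * c + 1 := by linarith [h2.1]
        have h5 : (n : ℝ) * c < i + 1 := by linarith [h2.2]
        norm_cast at h4 h5
        omega
      have hs0 : ∀ j, s (i, j) ↔ s (0, j) := fun j => by
        have := periodic_int_mul hper c 0 j
        rwa [zero_add, ← hi] at this
      rw [hs0, hs0] at h3
      have hjl : -L ≤ j := by
        by_contra! hj
        exact h3 (iff_of_true (hlow _ _ (by omega)) (hlow _ _ hj))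
      have hju : j ≤ L + 1 := by
        by_contra! hj
        exact h3 (iff_of_false (hhigh _ _ (by omega)) (hhigh _ _ (by omega)))
      refine Finset.mem_image.2 ⟨(j + L).toNat, Finset.mem_filter.2
        ⟨Finset.mem_range.2 (by omega), ?_⟩, ?_⟩
      · have e : -(L : ℤ) - 1 + ((j + L).toNat : ℤ) = j - 1 := by omega
        rwa [e, sub_add_cancel]
      · have e : (((j + L).toNat : ℕ) : ℝ) = j + L := by
          have : (((j + L).toNat : ℕ) : ℤ) = j + L := by omega
          exact_mod_cast this
        simp only [τ, e, Prod.mk.injEq]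
        constructor
        · rw [← sub_eq_zero, ← AddCircle.coe_sub, AddCircle.coe_eq_zero_iff]
          refine ⟨-c, ?_⟩
          simp only [zsmul_eq_mul, mul_one, Int.cast_neg]
          linarith
        · rw [← h1]
          field_simp
          ring
    · exfalso
      have h4 : (2 * i : ℝ) = 2 * (n * c) + 1 := by linarith
      norm_cast at h4
      omega
  · refine le_trans (mul_le_mul_of_nonneg_right (Nat.cast_le.2 Finset.card_image_le) hw.le) ?_
    exact card_mul_le_of_lowerSide hn hX hY hd hXA hYA hnw hsep hH0 hH
      (hlowX 0 (-L - 1) (by omega)) _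

/-- A lift of an injective arc crosses translates of a vertical line at different points. -/
theorem loopDistortion_le {Γ : Set 𝔸} {x : ℝ} {S : Finset 𝔸}
    (hS : ∀ p ∈ Γ, p.1 = (x : 𝕊) → p ∈ S) : loopDistortion Γ ≤ S.card + 1 := by
  refine Real.sSup_le ?_ (by positivity)
  rintro _ ⟨a, b, σ, hab, hσ, hσi, hσΓ, rfl⟩
  by_cases hlift : ∃ σt, IsLiftOn σt σ a b
  · obtain ⟨σt, hσt⟩ := hlift
    have hD : Dval σ a b ≤ diam (Prod.fst '' (σt '' Icc a b)) := by
      refine csInf_le ⟨0, ?_⟩ ⟨σt, hσt, rfl⟩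
      rintro _ ⟨_, -, rfl⟩
      exact diam_nonneg
    refine hD.trans ?_
    refine diam_le_of_forall_dist_le (by positivity) ?_
    have key : ∀ t ∈ Icc a b, ∀ t' ∈ Icc a b, (σt t').1 - (σt t).1 ≤ S.card + 1 := by
      intro t ht t' ht'
      by_contra! hlt
      set c := ⌈(σt t).1 - x⌉ with hc
      have hc1 := Int.le_ceil ((σt t).1 - x)
      have hc2 := Int.ceil_lt_add_one ((σt t).1 - x)
      have hpre : ∀ i ∈ Finset.range (S.card + 1), ∃ u ∈ Icc a b, (σt u).1 = x + c + i := by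
        intro i hi
        have hi' : (i : ℝ) ≤ S.card := by
          exact_mod_cast Nat.lt_succ_iff.1 (Finset.mem_range.1 hi)
        have himg : IsPreconnected ((fun u => (σt u).1) '' Icc a b) :=
          isPreconnected_Icc.image _ (continuous_fst.comp_continuousOn hσt.1)
        exact himg.ordConnected.out ⟨t, ht, rfl⟩ ⟨t', ht', rfl⟩
          ⟨by simp only; linarith [(Nat.cast_nonneg i : (0 : ℝ) ≤ i)], by simp only; linarith⟩
      choose! u hu hux using hpre
      have := Finset.card_le_card_of_injOn (s := Finset.range (S.card + 1)) (t := S)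
        (fun i => σ (u i)) (fun i hi => hS _ (hσΓ (mem_image_of_mem _ (hu i hi))) ?_) ?_
      · simp at this
      · beta_reduce
        rw [← hσt.2 _ (hu i hi), τ, hux i hi]
        simp only
        rw [← sub_eq_zero, ← AddCircle.coe_sub, AddCircle.coe_eq_zero_iff]
        exact ⟨c + i, by simp; ring⟩
      · intro i hi i' hi' h
        have h1 := hux i hi
        rw [hσi (hu i hi) (hu i' hi') h, hux i' hi'] at h1
        have : (i' : ℝ) = i := by linarith
        exact_mod_cast this.symm
    rintro _ ⟨_, ⟨t, ht, rfl⟩, rfl⟩ _ ⟨_, ⟨t', ht', rfl⟩, rfl⟩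
    rw [Real.dist_eq]
    exact abs_sub_le_iff.2 ⟨key t' ht' t ht, key t ht t' ht'⟩
  · have : Dval σ a b = 0 := by
      rw [Dval, ← Real.sInf_empty]
      congr 1
      exact eq_empty_of_forall_notMem fun r ⟨σt, h, _⟩ => hlift ⟨σt, h⟩
    rw [this]
    positivity

theorem loopDistortion_nonneg (Γ : Set 𝔸) : 0 ≤ loopDistortion Γ := by
  refine Real.sSup_nonneg ?_
  rintro _ ⟨a, b, σ, -, -, -, -, rfl⟩
  refine Real.sInf_nonneg ?_
  rintro _ ⟨σt, -, rfl⟩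
  exact diam_nonneg

theorem annDistortion_le {A Γ : Set 𝔸} (hΓ : IsEssentialSimpleLoop Γ) (hΓA : Γ ⊆ A) :
    annDistortion A ≤ loopDistortion Γ := by
  refine csInf_le ⟨0, ?_⟩ ⟨Γ, hΓ, hΓA, rfl⟩
  rintro _ ⟨Γ', -, -, rfl⟩
  exact loopDistortion_nonneg Γ'

theorem lower_width_bounded_by_distortion
    (A : Set 𝔸) (hA : IsClosedEssentialAnnulus A)
    (hdist : 1 < annDistortion A) :
    lw A ≤ Metric.diam (Prod.snd '' A) / (annDistortion A - 1) := by
  have hd : 0 < annDistortion A - 1 := sub_pos.2 hdist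
  have hAb : Bornology.IsBounded (Prod.snd '' A) := by
    obtain ⟨⟨φ, hφ, -, rfl⟩, -⟩ := hA
    exact ((isCompact_range hφ).image continuous_snd).isBounded
  have hH : ∀ p ∈ A, ∀ q ∈ A, q.2 - p.2 ≤ Metric.diam (Prod.snd '' A) := fun p hp q hq =>
    (le_abs_self _).trans (Metric.dist_le_diam_of_mem hAb (mem_image_of_mem _ hq)
      (mem_image_of_mem _ hp))
  have hrhs : 0 ≤ Metric.diam (Prod.snd '' A) / (annDistortion A - 1) :=
    div_nonneg Metric.diam_nonneg hd.le
  refine Real.sSup_le ?_ hrhs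
  rintro _ ⟨C₁, C₂, h₁, h₂, hC₁, hC₂, rfl⟩
  rcases le_or_gt (setDist C₁ C₂) 0 with hw | hw
  · exact hw.trans hrhs
  set w := setDist C₁ C₂
  have hsep : ∀ p ∈ C₁, ∀ q ∈ C₂, w ≤ dist p q := fun p hp q hq =>
    csInf_le ⟨0, by rintro _ ⟨_, -, _, -, rfl⟩; exact dist_nonneg⟩ ⟨p, hp, q, hq, rfl⟩
  have hdisj : Disjoint C₁ C₂ := Set.disjoint_left.2 fun p hp hp' =>
    absurd (hsep p hp p hp') (by simpa using hw)
  obtain ⟨X, Y, hX, hY, hXY, hf, ⟨M, hM⟩, hXYA⟩ := hA.exists_ends h₁ h₂ hC₁ hC₂ hdisj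
  obtain ⟨hXA, hYA, hsep'⟩ : frontier X ⊆ A ∧ frontier Y ⊆ A ∧
      ∀ a ∈ frontier X, ∀ b ∈ frontier Y, w ≤ dist a b := by
    rcases hf with ⟨hfX, hfY⟩ | ⟨hfX, hfY⟩
    · exact ⟨hfX.trans hC₁, hfY.trans hC₂, fun a ha b hb => hsep a (hfX ha) b (hfY hb)⟩
    · exact ⟨hfX.trans hC₂, hfY.trans hC₁, fun a ha b hb =>
        dist_comm b a ▸ hsep b (hfY hb) a (hfX ha)⟩
  obtain ⟨Γ, hΓA, hΓ, x, S, hS, hcard⟩ := exists_essentialSimpleLoop_card_le hX hY hXY hXA hYA hw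
    hsep' Metric.diam_nonneg hH hM hXYA
  have h := (annDistortion_le hΓ hΓA).trans (loopDistortion_le hS)
  rw [le_div_iff₀ hd]
  nlinarith
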